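/- arXiv:1307.4203 — 5 statements merged into one kernel-verified Lean document; each statement's English description precedes it below -/
import Mathlib

section
/- Let G ⊆ ℂ be a Jordan domain, let ψ be a univalent analytic map from the open unit disk D onto G, and suppose Ψ is a continuous function on the closed unit disk with Ψ = ψ on D. Then Ψ is injective on the closed unit disk. -/
/-- `Γ` is a Jordan curve: the image of an injective continuous map
from the unit circle into `ℂ`. -/
def IsJordanCurve (Γ : Set ℂ) : Prop :=
  ∃ f : ℂ → ℂ, ContinuousOn f (Metric.sphere (0 : ℂ) 1) ∧
    Set.InjOn f (Metric.sphere (0 : ℂ) 1) ∧ Γ = f '' Metric.sphere (0 : ℂ) 1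

/-- `G` is a Jordan domain: a bounded nonempty open connected set that is a
connected component of the complement of a Jordan curve `Γ` with `∂G = Γ`. -/
def IsJordanDomain (G : Set ℂ) : Prop :=
  IsOpen G ∧ IsConnected G ∧ Bornology.IsBounded G ∧
    ∃ Γ : Set ℂ, IsJordanCurve Γ ∧ frontier G = Γ ∧
      ∃ z ∈ G, G = connectedComponentIn Γᶜ z

open Set Metric Filter Topology

/-- `c` is the increment over `[0, 1]` of a continuous logarithm of `γ - w`. -/
def HasLogIncrement (γ : ℝ → ℂ) (w c : ℂ) : Prop :=
  ∃ l : ℝ → ℂ, ContinuousOn l (Icc 0 1) ∧ (∀ t ∈ Icc (0 : ℝ) 1, Complex.exp (l t) = γ t - w) ∧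
    l 1 - l 0 = c

theorem HasLogIncrement.unique {γ : ℝ → ℂ} {w c c' : ℂ} (h : HasLogIncrement γ w c)
    (h' : HasLogIncrement γ w c') : c = c' := by
  obtain ⟨l, hl, hle, rfl⟩ := h
  obtain ⟨l', hl', hle', rfl⟩ := h'
  have key : l 1 - l' 1 = l 0 - l' 0 := by
    refine Complex.isCoveringMap_exp.constOn_of_comp (isPreconnected_Icc (a := (0 : ℝ)) (b := 1))
      (hl.sub hl') ?_ (by simp) (by simp)
    intro s hs t ht
    have aux : ∀ u ∈ Icc (0 : ℝ) 1, Complex.exp (l u - l' u) = 1 := fun u hu ↦ by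
      rw [Complex.exp_sub, hle u hu, ← hle' u hu, div_self (Complex.exp_ne_zero _)]
    simp [aux s hs, aux t ht]
  linear_combination key

theorem HasLogIncrement.of_norm_sub_lt {γ : ℝ → ℂ} {w w' c : ℂ} (hγ : ContinuousOn γ (Icc 0 1))
    (hγ01 : γ 0 = γ 1) (h : HasLogIncrement γ w c)
    (hw : ∀ t ∈ Icc (0 : ℝ) 1, ‖w' - w‖ < ‖γ t - w‖) : HasLogIncrement γ w' c := by
  obtain ⟨l, hl, hle, rfl⟩ := h
  have hne : ∀ t ∈ Icc (0 : ℝ) 1, γ t - w ≠ 0 := fun t ht ↦ by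
    rw [← hle t ht]; exact Complex.exp_ne_zero _
  have hmem : ∀ t ∈ Icc (0 : ℝ) 1, (γ t - w') / (γ t - w) ∈ Complex.slitPlane := by
    intro t ht
    refine Complex.ball_one_subset_slitPlane ?_
    have : (γ t - w') / (γ t - w) - 1 = (w - w') / (γ t - w) := by
      field_simp [hne t ht]; ring
    rw [mem_ball, dist_eq_norm, this, norm_div, norm_sub_rev w,
      div_lt_one (norm_pos_iff.2 (hne t ht))]
    exact hw t ht
  refine ⟨fun t ↦ l t + Complex.log ((γ t - w') / (γ t - w)), ?_, ?_, ?_⟩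
  · exact hl.add (ContinuousOn.clog
      ((hγ.sub continuousOn_const).div (hγ.sub continuousOn_const) hne) hmem)
  · intro t ht
    rw [Complex.exp_add, hle t ht, Complex.exp_log (Complex.slitPlane_ne_zero (hmem t ht)),
      mul_div_cancel₀ _ (hne t ht)]
  · simp [hγ01]

theorem HasLogIncrement.of_isPreconnected {γ : ℝ → ℂ} (hγ : ContinuousOn γ (Icc 0 1))
    (hγ01 : γ 0 = γ 1) {S : Set ℂ} (hS : IsPreconnected S)
    (hSγ : ∀ t ∈ Icc (0 : ℝ) 1, γ t ∉ S) {w w' c : ℂ} (hw : w ∈ S) (hw' : w' ∈ S)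
    (h : HasLogIncrement γ w c) : HasLogIncrement γ w' c := by
  have hK : IsCompact (γ '' Icc 0 1) := isCompact_Icc.image_of_continuousOn hγ
  refine hS.induction₂' (fun x y ↦ HasLogIncrement γ x c → HasLogIncrement γ y c) ?_
    (fun x y z _ _ _ hxy hyz hx ↦ hyz (hxy hx)) hw hw' h
  intro x hx
  have hx' : x ∈ (γ '' Icc 0 1)ᶜ := by
    rintro ⟨t, ht, rfl⟩
    exact hSγ t ht hx
  obtain ⟨ε, hε, hball⟩ := Metric.isOpen_iff.1 hK.isClosed.isOpen_compl x hx'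
  have hfar : ∀ t ∈ Icc (0 : ℝ) 1, ε ≤ ‖γ t - x‖ := by
    intro t ht
    by_contra! hlt
    exact hball (by rwa [mem_ball, dist_eq_norm]) ⟨t, ht, rfl⟩
  filter_upwards [nhdsWithin_le_nhds (ball_mem_nhds x (half_pos hε))] with y hy
  rw [mem_ball, dist_eq_norm] at hy
  refine ⟨fun hP ↦ hP.of_norm_sub_lt hγ hγ01 fun t ht ↦ by linarith [hfar t ht],
    fun hP ↦ hP.of_norm_sub_lt hγ hγ01 fun t ht ↦ ?_⟩
  have : ‖γ t - x‖ ≤ ‖γ t - y‖ + ‖y - x‖ := by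
    simpa using norm_add_le (γ t - y) (y - x)
  rw [norm_sub_rev]
  linarith [hfar t ht]

theorem continuousOn_dslope_uncurry {f : ℂ → ℂ} {s t : Set ℂ} (ht : IsOpen t) (hts : t ⊆ s)
    (hf : ContinuousOn f s) (hfd : DifferentiableOn ℂ f t) :
    ContinuousOn (fun p : ℂ × ℂ ↦ dslope f p.2 p.1) (s ×ˢ t) := by
  rintro ⟨x, y⟩ ⟨hx, hy⟩
  by_cases hxy : x = y
  · subst hxy
    refine ContinuousAt.continuousWithinAt ?_
    have han : AnalyticAt ℂ f x := hfd.analyticAt (ht.mem_nhds hy)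
    have hd : ContinuousAt (fun p : ℂ × ℂ ↦ deriv f p.2) (x, x) :=
      han.deriv.continuousAt.comp_of_eq continuousAt_snd rfl
    have hs := han.hasStrictDerivAt
    replace hs := hs.hasStrictFDerivAt.isLittleO
    rw [Metric.continuousAt_iff'] at hd ⊢
    intro ε hε
    filter_upwards [hd ε hε, hs.bound (half_pos hε)] with p hp1 hp2
    rw [dslope_same]
    by_cases hp : p.1 = p.2
    · rw [hp, dslope_same]; exact hp1
    · rw [dslope_of_ne _ hp, slope_def_field, dist_eq_norm]
      have hne : p.1 - p.2 ≠ 0 := sub_ne_zero.2 hp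
      have : (f p.1 - f p.2) / (p.1 - p.2) - deriv f x =
          (f p.1 - f p.2 - (p.1 - p.2) • deriv f x) / (p.1 - p.2) := by
        rw [smul_eq_mul]; field_simp
      rw [this, norm_div, div_lt_iff₀ (norm_pos_iff.2 hne)]
      rw [ContinuousLinearMap.toSpanSingleton_apply] at hp2
      have := norm_pos_iff.2 hne
      nlinarith
  · have h1 : ContinuousWithinAt (fun p : ℂ × ℂ ↦ (f p.1 - f p.2) / (p.1 - p.2))
        (s ×ˢ t) (x, y) := by
      refine ContinuousWithinAt.div (ContinuousWithinAt.sub ?_ ?_) (by fun_prop)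
        (sub_ne_zero.2 hxy)
      · exact ((hf x hx).comp continuousWithinAt_fst fun p hp ↦ hp.1)
      · exact ((hf y (hts hy)).comp continuousWithinAt_snd fun p hp ↦ hts hp.2)
    refine h1.congr_of_eventuallyEq ?_ ?_
    · have : ∀ᶠ p : ℂ × ℂ in 𝓝[s ×ˢ t] (x, y), p.1 ≠ p.2 :=
        nhdsWithin_le_nhds ((isOpen_ne_fun continuous_fst continuous_snd).mem_nhds hxy)
      filter_upwards [this] with p hp
      rw [dslope_of_ne _ hp, slope_def_field]
    · rw [dslope_of_ne _ hxy, slope_def_field]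

/-- A quantity whose sign tells on which side of the line through `a` and `b` the point `z` lies. -/
noncomputable def chordSide (a b z : ℂ) : ℝ := ((z - a) * (starRingEnd ℂ) (b - a)).im

theorem continuous_chordSide (a b : ℂ) : Continuous (chordSide a b) := by
  unfold chordSide
  fun_prop

theorem chordSide_swap (a b z : ℂ) : chordSide b a z = -chordSide a b z := by
  simp [chordSide]
  ring

theorem chordSide_chord (a b : ℂ) (t : ℝ) : chordSide a b (a + t * (b - a)) = 0 := by
  simp [chordSide]
  ring

theorem div_mem_slitPlane_of_chordSide_ne_zero {a b z : ℂ} (h : chordSide a b z ≠ 0) (t : ℝ) :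
    (a + t * (b - a) - z) / (a - z) ∈ Complex.slitPlane := by
  have haz : a - z ≠ 0 := by
    intro h0
    rw [← sub_eq_zero.1 h0] at h
    simp [chordSide] at h
  have heq : (a + t * (b - a) - z) / (a - z) = 1 + t * ((b - a) / (a - z)) := by
    field_simp
    ring
  rw [heq]
  rcases eq_or_ne t 0 with rfl | ht
  · simp
  · have hn : Complex.normSq (a - z) ≠ 0 := by simpa using haz
    have him : ((b - a) / (a - z)).im * Complex.normSq (a - z) = chordSide a b z := by
      rw [Complex.div_im]
      field_simp
      simp [chordSide]
      ring
    refine Or.inr ?_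
    have : ((b - a) / (a - z)).im ≠ 0 := fun h0 ↦ h (by rw [← him, h0, zero_mul])
    simp [ht, this]

theorem chord_mem_closedBall {a b : ℂ} (ha : ‖a‖ = 1) (hb : ‖b‖ = 1) {t : ℝ}
    (ht : t ∈ Icc (0 : ℝ) 1) : a + t * (b - a) ∈ closedBall (0 : ℂ) 1 := by
  have := (convex_closedBall (0 : ℂ) 1).add_smul_sub_mem (x := a) (y := b) (by simp [ha])
    (by simp [hb]) ht
  simpa using this

theorem chord_mem_ball {a b : ℂ} (ha : ‖a‖ = 1) (hb : ‖b‖ = 1) (hab : a ≠ b) {t : ℝ}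
    (ht : t ∈ Ioo (0 : ℝ) 1) : a + t * (b - a) ∈ ball (0 : ℂ) 1 := by
  have := (strictConvex_closedBall ℝ (0 : ℂ) 1).add_smul_sub_mem (x := a) (y := b) (by simp [ha])
    (by simp [hb]) hab ht.1 ht.2
  rw [interior_closedBall _ one_ne_zero] at this
  simpa using this

theorem exists_hasLogIncrement_chord {f : ℂ → ℂ} {a b m : ℂ} {r : ℝ} (hr : 0 < r)
    (ha : ‖a‖ = 1) (hb : ‖b‖ = 1) (hmr : ball m r ⊆ ball 0 1)
    (hf : ContinuousOn f (closedBall 0 1)) (hfd : DifferentiableOn ℂ f (ball 0 1))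
    (hne : ∀ x ∈ closedBall (0 : ℂ) 1, ∀ y ∈ ball m r, dslope f y x ≠ 0) :
    ∃ H : ℂ → ℂ, ContinuousOn H (ball m r) ∧ ∀ z ∈ ball m r, chordSide a b z ≠ 0 →
      HasLogIncrement (fun t ↦ f (a + t * (b - a))) (f z)
        (H z + Complex.log ((b - z) / (a - z))) := by
  let c : ℝ → ℂ := fun t ↦ a + (projIcc (0 : ℝ) 1 zero_le_one t : ℝ) * (b - a)
  have hcc : Continuous c := by
    have : Continuous fun t : ℝ ↦ ((projIcc (0 : ℝ) 1 zero_le_one t : ℝ)) :=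
      continuous_subtype_val.comp continuous_projIcc
    fun_prop
  have hcm : ∀ t, c t ∈ closedBall (0 : ℂ) 1 := fun t ↦ chord_mem_closedBall ha hb (Subtype.prop _)
  have hc : ∀ t ∈ Icc (0 : ℝ) 1, c t = a + t * (b - a) := fun t ht ↦ by
    simp only [c, projIcc_of_mem zero_le_one ht]
  have hUconv : Convex ℝ ((univ : Set ℝ) ×ˢ ball m r) := convex_univ.prod (convex_ball m r)
  have hUs : IsSimplyConnected ((univ : Set ℝ) ×ˢ ball m r) := by
    have := hUconv.contractibleSpace ⟨(0, m), mem_univ _, mem_ball_self hr⟩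
    unfold IsSimplyConnected
    infer_instance
  obtain ⟨g, hg, hge⟩ := Complex.exists_continuousOn_eqOn_exp_comp hUs
    (isOpen_univ.prod isOpen_ball) (g := fun p ↦ dslope f p.2 (c p.1))
    (((continuousOn_dslope_uncurry isOpen_ball (hmr.trans ball_subset_closedBall) hf
      (hfd.mono hmr)).comp (f := fun p : ℝ × ℂ ↦ (c p.1, p.2)) (by fun_prop)
        fun p hp ↦ ⟨hcm _, hp.2⟩))
    (by rintro ⟨p, hp, h0⟩; exact hne _ (hcm _) _ hp.2 h0)
  refine ⟨fun z ↦ g (1, z) - g (0, z), ?_, fun z hz hside ↦ ?_⟩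
  · exact (hg.comp (f := fun z ↦ ((1 : ℝ), z)) (by fun_prop) fun z hz ↦ ⟨mem_univ _, hz⟩).sub
      (hg.comp (f := fun z ↦ ((0 : ℝ), z)) (by fun_prop) fun z hz ↦ ⟨mem_univ _, hz⟩)
  · have hslit := div_mem_slitPlane_of_chordSide_ne_zero hside
    have haz : a - z ≠ 0 := by
      intro h0
      rw [← sub_eq_zero.1 h0] at hside
      simp [chordSide] at hside
    refine ⟨fun t ↦ g (t, z) + Complex.log ((a + t * (b - a) - z) / (a - z)) + Complex.log (a - z),
      ?_, fun t ht ↦ ?_, ?_⟩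
    · refine ContinuousOn.add (ContinuousOn.add ?_ ?_) continuousOn_const
      · exact hg.comp (f := fun t : ℝ ↦ (t, z)) (by fun_prop) fun t ht ↦ ⟨mem_univ _, hz⟩
      · exact ContinuousOn.clog (by fun_prop) fun t _ ↦ hslit t
    · have h1 : Complex.exp (g (t, z)) = dslope f z (a + t * (b - a)) := by
        have := hge (x := (t, z)) ⟨mem_univ _, hz⟩
        simpa [hc t ht] using this
      have h2 : a + t * (b - a) - z ≠ 0 := fun h0 ↦ by
        have := Complex.slitPlane_ne_zero (hslit t)
        simp [h0] at this
      rw [Complex.exp_add, Complex.exp_add, h1, Complex.exp_log (Complex.slitPlane_ne_zero (hslit t)),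
        Complex.exp_log haz, dslope_of_ne _ (sub_ne_zero.1 h2), slope_def_field]
      field_simp
    · have : a + (b - a) - z = b - z := by ring
      simp [haz]
      ring

theorem pi_lt_norm_log_sub_log {τ s : ℝ} (hs : 0 < s) (hsτ : s ^ 2 < τ * (1 - τ)) :
    Real.pi < ‖Complex.log ((1 - τ - s * Complex.I) / (-τ - s * Complex.I)) -
      Complex.log ((1 - τ + s * Complex.I) / (-τ + s * Complex.I))‖ := by
  set v := (1 - τ - s * Complex.I) / (-τ - s * Complex.I) with hv
  have hv2 : (1 - τ + s * Complex.I) / (-τ + s * Complex.I) = (starRingEnd ℂ) v := by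
    simp [hv]
  have hN : 0 < τ ^ 2 + s ^ 2 := by positivity
  have hnsq : Complex.normSq (-τ - s * Complex.I) = τ ^ 2 + s ^ 2 := by
    simp [Complex.normSq_apply]; ring
  have hre : v.re = (s ^ 2 - τ * (1 - τ)) / (τ ^ 2 + s ^ 2) := by
    rw [hv, Complex.div_re, hnsq]; simp; ring
  have him : v.im = s / (τ ^ 2 + s ^ 2) := by
    rw [hv, Complex.div_im, hnsq]; simp; ring
  have hre0 : v.re < 0 := by rw [hre]; exact div_neg_of_neg_of_pos (by linarith) hN
  have him0 : 0 < v.im := by rw [him]; positivity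
  have harg : v.arg ≠ Real.pi := fun h ↦ by
    rw [Complex.arg_eq_pi_iff] at h
    exact him0.ne' h.2
  have habs : Real.pi / 2 < |v.arg| := by
    by_contra! h
    rw [Complex.abs_arg_le_pi_div_two_iff] at h
    linarith
  rw [hv2, Complex.log_conj _ harg, Complex.sub_conj, Complex.log_im]
  simp only [norm_mul, Complex.norm_real, Complex.norm_I, mul_one, Real.norm_eq_abs, abs_two]
  linarith

theorem exists_hasLogIncrement_ne {f : ℂ → ℂ} {a b : ℂ} (ha : ‖a‖ = 1) (hb : ‖b‖ = 1)
    (hab : a ≠ b) (hf : ContinuousOn f (closedBall 0 1))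
    (hfd : DifferentiableOn ℂ f (ball 0 1))
    (hinj : ∀ x ∈ closedBall (0 : ℂ) 1, ∀ y ∈ ball (0 : ℂ) 1, f x = f y → x = y) :
    ∃ z₁ ∈ ball (0 : ℂ) 1, ∃ z₂ ∈ ball (0 : ℂ) 1, ∃ c₁ c₂, 0 < chordSide a b z₁ ∧
      chordSide a b z₂ < 0 ∧ c₁ ≠ c₂ ∧
      HasLogIncrement (fun t ↦ f (a + t * (b - a))) (f z₁) c₁ ∧
      HasLogIncrement (fun t ↦ f (a + t * (b - a))) (f z₂) c₂ := by
  obtain ⟨τ, hτ, hdτ⟩ : ∃ τ ∈ Ioo (0 : ℝ) 1, deriv f (a + τ * (b - a)) ≠ 0 := by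
    by_contra! hzero
    have hd : ∀ t ∈ Ioo (0 : ℝ) 1, HasDerivAt (fun t : ℝ ↦ f (a + t * (b - a))) 0 t := by
      intro t ht
      have h1 := ((hfd.differentiableAt (isOpen_ball.mem_nhds
        (chord_mem_ball ha hb hab ht))).hasDerivAt)
      rw [hzero t ht] at h1
      have h2 : HasDerivAt (fun t : ℝ ↦ a + t * (b - a)) (b - a) t := by
        simpa using ((Complex.ofRealCLM.hasDerivAt (x := t)).mul_const (b - a)).const_add a
      have h3 := h1.comp t h2
      rw [zero_mul] at h3
      exact h3
    obtain ⟨k, hk⟩ := isOpen_Ioo.exists_is_const_of_deriv_eq_zero isPreconnected_Ioo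
      (fun t ht ↦ (hd t ht).differentiableAt.differentiableWithinAt) (fun t ht ↦ (hd t ht).deriv)
    have h3 : (1 / 3 : ℝ) ∈ Ioo (0 : ℝ) 1 := by constructor <;> norm_num
    have h4 : (1 / 2 : ℝ) ∈ Ioo (0 : ℝ) 1 := by constructor <;> norm_num
    have := hinj _ (ball_subset_closedBall (chord_mem_ball ha hb hab h3)) _
      (chord_mem_ball ha hb hab h4) ((hk _ h3).trans (hk _ h4).symm)
    have h5 : (b - a) * (1 / 6) = 0 := by
      push_cast at this
      linear_combination -this
    exact hab (by simpa [sub_eq_zero, eq_comm] using h5)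
  set m := a + τ * (b - a) with hm
  have hmb : m ∈ ball (0 : ℂ) 1 := chord_mem_ball ha hb hab hτ
  have hdc : ContinuousAt (deriv f) m :=
    (hfd.analyticAt (isOpen_ball.mem_nhds hmb)).deriv.continuousAt
  obtain ⟨r, hr, hball⟩ := Metric.eventually_nhds_iff_ball.1
    ((hdc.eventually_ne hdτ).and (isOpen_ball.mem_nhds hmb))
  obtain ⟨H, hHc, hH⟩ := exists_hasLogIncrement_chord hr ha hb (fun z hz ↦ (hball z hz).2) hf hfd
    (by
      intro x hx y hy
      rcases eq_or_ne x y with rfl | hxy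
      · rw [dslope_same]; exact (hball _ hy).1
      · rw [dslope_of_ne _ hxy, slope_def_field]
        exact div_ne_zero (sub_ne_zero.2 fun h ↦ hxy (hinj x hx y (hball y hy).2 h))
          (sub_ne_zero.2 hxy))
  have hHm : ContinuousAt H m := hHc.continuousAt (ball_mem_nhds m hr)
  have hnear : ∀ᶠ z in 𝓝 m, z ∈ ball m r ∧ dist (H z) (H m) < 1 :=
    Filter.Eventually.and (ball_mem_nhds m hr) (Metric.tendsto_nhds.1 hHm 1 one_pos)
  have ht1 : Tendsto (fun s : ℝ ↦ m + s * (Complex.I * (b - a))) (𝓝 0) (𝓝 m) :=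
    (Continuous.tendsto' (by fun_prop) _ _ (by simp))
  have ht2 : Tendsto (fun s : ℝ ↦ m - s * (Complex.I * (b - a))) (𝓝 0) (𝓝 m) :=
    (Continuous.tendsto' (by fun_prop) _ _ (by simp))
  have ht3 : Tendsto (fun s : ℝ ↦ s ^ 2) (𝓝 0) (𝓝 0) :=
    (Continuous.tendsto' (by fun_prop) _ _ (by simp))
  have hτpos : 0 < τ * (1 - τ) := mul_pos hτ.1 (by linarith [hτ.2])
  obtain ⟨s, ⟨⟨hs1, hs2⟩, hs3⟩, hs0⟩ := ((((ht1.eventually hnear).and (ht2.eventually hnear)).and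
    (ht3.eventually_lt_const hτpos)).filter_mono (nhdsWithin_le_nhds (s := Ioi 0))
    |>.and self_mem_nhdsWithin).exists
  have hs0 : 0 < s := hs0
  have hba : b - a ≠ 0 := sub_ne_zero.2 hab.symm
  have hside : ∀ u : ℝ, chordSide a b (m + u * (Complex.I * (b - a))) =
      u * Complex.normSq (b - a) := fun u ↦ by
    simp [chordSide, hm, Complex.normSq_apply]
    ring
  have hnsq : 0 < Complex.normSq (b - a) := Complex.normSq_pos.2 hba
  have hside1 : 0 < chordSide a b (m + s * (Complex.I * (b - a))) := by
    rw [hside]; positivity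
  have hside2 : chordSide a b (m - s * (Complex.I * (b - a))) < 0 := by
    have := hside (-s)
    rw [Complex.ofReal_neg, neg_mul, ← sub_eq_add_neg] at this
    rw [this, neg_mul]
    exact neg_neg_of_pos (by positivity)
  refine ⟨_, (hball _ hs1.1).2, _, (hball _ hs2.1).2, _, _, hside1, hside2, ?_,
    hH _ hs1.1 hside1.ne', hH _ hs2.1 hside2.ne⟩
  intro heq
  have e1 : (b - (m + s * (Complex.I * (b - a)))) / (a - (m + s * (Complex.I * (b - a)))) =
      (1 - τ - s * Complex.I) / (-τ - s * Complex.I) := by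
    rw [← mul_div_mul_right (1 - τ - s * Complex.I) (-τ - s * Complex.I) hba, hm]
    congr 1 <;> ring
  have e2 : (b - (m - s * (Complex.I * (b - a)))) / (a - (m - s * (Complex.I * (b - a)))) =
      (1 - τ + s * Complex.I) / (-τ + s * Complex.I) := by
    rw [← mul_div_mul_right (1 - τ + s * Complex.I) (-τ + s * Complex.I) hba, hm]
    congr 1 <;> ring
  have hpi := pi_lt_norm_log_sub_log hs0 hs3
  rw [e1, e2] at heq
  have hle := dist_triangle_right (H (m - s * (Complex.I * (b - a))))
    (H (m + s * (Complex.I * (b - a)))) (H m)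
  rw [dist_eq_norm] at hle
  rw [show Complex.log ((1 - τ - s * Complex.I) / (-τ - s * Complex.I)) -
      Complex.log ((1 - τ + s * Complex.I) / (-τ + s * Complex.I)) =
      H (m - s * (Complex.I * (b - a))) - H (m + s * (Complex.I * (b - a))) by
    linear_combination heq] at hpi
  linarith [Real.pi_gt_three, hs1.2, hs2.2]

theorem eq_of_apply_eq_of_injOn_ball {f : ℂ → ℂ} (hf : ContinuousOn f (closedBall 0 1))
    (hfd : DifferentiableOn ℂ f (ball 0 1)) (hfi : InjOn f (ball 0 1)) {x y : ℂ}
    (hx : x ∈ closedBall (0 : ℂ) 1) (hy : y ∈ ball (0 : ℂ) 1) (hxy : f x = f y) : x = y := by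
  by_contra hne
  obtain ⟨U, V, hU, hV, hxU, hyV, hUV⟩ := t2_separation hne
  have hopen : 𝓝 (f y) ≤ map f (𝓝 y) := by
    refine (hfd.analyticAt (isOpen_ball.mem_nhds hy)).eventually_constant_or_nhds_le_map_nhds
      |>.resolve_left fun hconst ↦ ?_
    have h1 : ∀ᶠ z in 𝓝[≠] y, f z = f y ∧ z ∈ ball (0 : ℂ) 1 :=
      (hconst.and (isOpen_ball.mem_nhds hy)).filter_mono nhdsWithin_le_nhds
    obtain ⟨z, ⟨hz, hzb⟩, hzy⟩ := (h1.and self_mem_nhdsWithin).exists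
    exact hzy (hfi hzb hy hz)
  have hmem : f '' (V ∩ ball 0 1) ∈ 𝓝 (f x) := by
    rw [hxy]
    exact hopen (image_mem_map (inter_mem (hV.mem_nhds hyV) (isOpen_ball.mem_nhds hy)))
  have hcl : x ∈ closure (ball (0 : ℂ) 1) := by rwa [closure_ball _ one_ne_zero]
  have := mem_closure_iff_nhdsWithin_neBot.1 hcl
  have htend : Tendsto f (𝓝[ball 0 1] x) (𝓝 (f x)) := (hf x hx).mono ball_subset_closedBall
  obtain ⟨z, ⟨⟨v, ⟨hvV, hvb⟩, hvz⟩, hzU⟩, hzb⟩ := (((htend.eventually hmem).and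
    (nhdsWithin_le_nhds (hU.mem_nhds hxU))).and self_mem_nhdsWithin).exists
  have hvz' : v = z := hfi hvb hzb hvz
  exact hUV.ne_of_mem hzU hvV hvz'.symm

theorem apply_zero_eq_of_eq_on_arc {f : ℂ → ℂ} (hf : ContinuousOn f (closedBall 0 1))
    (hfd : DifferentiableOn ℂ f (ball 0 1)) {U : Set ℂ} (hU : IsOpen U) {w ζ₀ : ℂ}
    (hζ₀ : ‖ζ₀‖ = 1) (hζ₀U : ζ₀ ∈ U) (hw : ∀ ζ ∈ U, ‖ζ‖ = 1 → f ζ = w) : f 0 = w := by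
  obtain ⟨t, ht⟩ := (isCompact_sphere (0 : ℂ) 1).elim_finite_subcover
    (fun u : sphere (0 : ℂ) 1 ↦ (fun z ↦ u * z) ⁻¹' U) (fun u ↦ hU.preimage (by fun_prop))
    (by
      intro ζ hζ
      have hζ1 : ‖ζ‖ = 1 := by simpa using hζ
      have hζ0 : ζ ≠ 0 := by rintro rfl; simp at hζ1
      refine mem_iUnion.2 ⟨⟨ζ₀ / ζ, by simp [hζ₀, hζ1]⟩, ?_⟩
      simpa [hζ0] using hζ₀U)
  have hu : ∀ u : sphere (0 : ℂ) 1, ‖(u : ℂ)‖ = 1 := fun u ↦ by simp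
  let P : ℂ → ℂ := fun z ↦ ∏ u ∈ t, (f (u * z) - w)
  have hPc : ContinuousOn P (closedBall 0 1) := by
    refine continuousOn_finsetProd _ fun u _ ↦ ContinuousOn.sub ?_ continuousOn_const
    exact hf.comp (by fun_prop) fun z hz ↦ by simpa [hu u] using hz
  have hPd : DifferentiableOn ℂ P (ball 0 1) := by
    refine DifferentiableOn.fun_finsetProd fun u _ ↦ DifferentiableOn.sub_const ?_ _
    exact hfd.comp (by fun_prop) fun z hz ↦ by simpa [hu u] using hz
  have hP0 : ‖P 0‖ ≤ 0 := by
    refine Complex.norm_le_of_forall_mem_frontier_norm_le isBounded_ball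
      (DiffContOnCl.mk_ball hPd hPc) (fun z hz ↦ ?_) (subset_closure (mem_ball_self one_pos))
    rw [frontier_ball _ one_ne_zero] at hz
    have hz1 : ‖z‖ = 1 := by simpa using hz
    obtain ⟨u, hut, huz⟩ := mem_iUnion₂.1 (ht hz)
    have hzero : f (u * z) - w = 0 := sub_eq_zero.2 (hw _ huz (by simp [hz1]))
    have hPz : P z = 0 := Finset.prod_eq_zero hut hzero
    rw [hPz, norm_zero]
  obtain ⟨u, -, hu0⟩ := Finset.prod_eq_zero_iff.1 (norm_le_zero_iff.1 hP0)
  simpa [sub_eq_zero] using hu0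

theorem exists_norm_eq_one_chordSide_pos {a b : ℂ} (ha : ‖a‖ = 1) (hb : ‖b‖ = 1) (hab : a ≠ b) :
    ∃ ζ : ℂ, ‖ζ‖ = 1 ∧ 0 < chordSide a b ζ := by
  have hba : b - a ≠ 0 := sub_ne_zero.2 hab.symm
  have hn : 0 < ‖b - a‖ := norm_pos_iff.2 hba
  have hsq : ∀ z : ℂ, ‖z‖ ^ 2 = z.re ^ 2 + z.im ^ 2 := fun z ↦ by
    rw [Complex.sq_norm, Complex.normSq_apply]; ring
  have ha2 : a.re ^ 2 + a.im ^ 2 = 1 := by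
    rw [← hsq, ha, one_pow]
  have hb2 : b.re ^ 2 + b.im ^ 2 = 1 := by
    rw [← hsq, hb, one_pow]
  have hn2 : ‖b - a‖ ^ 2 = (b.re - a.re) ^ 2 + (b.im - a.im) ^ 2 := by
    rw [hsq, Complex.sub_re, Complex.sub_im]
  refine ⟨Complex.I * (b - a) / ‖b - a‖, by simp [hn.ne'], ?_⟩
  have hval : chordSide a b (Complex.I * (b - a) / ‖b - a‖) =
      ‖b - a‖ - (a.im * b.re - a.re * b.im) := by
    have h1 : (Complex.I * (b - a) / ‖b - a‖) * (starRingEnd ℂ) (b - a) =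
        Complex.I * (‖b - a‖ : ℝ) := by
      rw [div_mul_eq_mul_div, mul_assoc, Complex.mul_conj']
      have : (‖b - a‖ : ℂ) ≠ 0 := by exact_mod_cast hn.ne'
      field_simp
    rw [chordSide, sub_mul, h1]
    simp
    ring
  rw [hval, sub_pos]
  refine lt_of_pow_lt_pow_left₀ 2 hn.le ?_
  have hid : (a.im * b.re - a.re * b.im) ^ 2 + (a.re * b.re + a.im * b.im) ^ 2 = 1 := by
    linear_combination (b.re ^ 2 + b.im ^ 2) * ha2 + hb2
  have hn3 : ‖b - a‖ ^ 2 = 2 - 2 * (a.re * b.re + a.im * b.im) := by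
    linear_combination hn2 + ha2 + hb2
  have hpos : 0 < ‖b - a‖ ^ 2 := by positivity
  have hlt : a.re * b.re + a.im * b.im < 1 := by linarith
  rw [hn3]
  nlinarith [sq_pos_of_pos (sub_pos.2 hlt)]

theorem isPreconnected_insert_halfDisc {a b ζ : ℂ} (hζ : ‖ζ‖ = 1) (hside : 0 < chordSide a b ζ) :
    IsPreconnected (insert ζ (ball (0 : ℂ) 1 ∩ {z | 0 < chordSide a b z})) := by
  have hlin : IsLinearMap ℝ fun z : ℂ ↦ (z * (starRingEnd ℂ) (b - a)).im :=
    ⟨fun x y ↦ by rw [add_mul, Complex.add_im], fun c x ↦ by rw [smul_mul_assoc, Complex.smul_im]⟩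
  have hset : {z | 0 < chordSide a b z} = {z | (a * (starRingEnd ℂ) (b - a)).im <
      (z * (starRingEnd ℂ) (b - a)).im} := by
    ext z
    rw [mem_ofPred_eq, mem_ofPred_eq, chordSide, sub_mul, Complex.sub_im, sub_pos]
  have hconv : Convex ℝ (ball (0 : ℂ) 1 ∩ {z | 0 < chordSide a b z}) := by
    rw [hset]
    exact (convex_ball _ _).inter (convex_halfSpace_gt hlin _)
  refine hconv.isPreconnected.subset_closure (subset_insert _ _) (insert_subset ?_ subset_closure)
  have hopen : IsOpen {z | 0 < chordSide a b z} :=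
    isOpen_lt continuous_const (continuous_chordSide a b)
  have hcl : ζ ∈ closure (ball (0 : ℂ) 1) := by
    rw [closure_ball _ one_ne_zero]
    simp [hζ]
  rw [inter_comm]
  exact hopen.inter_closure ⟨hside, hcl⟩

theorem isPreconnected_sphere_diff_singleton {x : ℂ} (hx : x ∈ sphere (0 : ℂ) 1) :
    IsPreconnected (sphere (0 : ℂ) 1 \ {x}) := by
  have hx1 : ‖x‖ = 1 := by simpa using hx
  have hx0 : x ≠ 0 := by rintro rfl; simp at hx1
  have himage : sphere (0 : ℂ) 1 \ {x} =
      (fun θ : ℝ ↦ -x * Complex.exp (θ * Complex.I)) '' Ioo (-Real.pi) Real.pi := by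
    ext z
    constructor
    · rintro ⟨hz, hzx⟩
      have hz1 : ‖z‖ = 1 := by simpa using hz
      have hnorm : ‖-z / x‖ = 1 := by simp [hz1, hx1]
      have hexp : Complex.exp ((-z / x).arg * Complex.I) = -z / x := by
        have := Complex.norm_mul_exp_arg_mul_I (-z / x)
        rwa [hnorm, Complex.ofReal_one, one_mul] at this
      refine ⟨(-z / x).arg, ⟨Complex.neg_pi_lt_arg _, lt_of_le_of_ne (Complex.arg_le_pi _) ?_⟩, ?_⟩
      · intro harg
        rw [harg, Complex.exp_pi_mul_I] at hexp
        field_simp at hexp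
        exact hzx (by simpa using (neg_injective hexp).symm)
      · simp only [hexp]
        field_simp
    · rintro ⟨θ, hθ, rfl⟩
      refine ⟨by simp [hx1], fun h ↦ ?_⟩
      have h1 : Complex.exp (θ * Complex.I) = -1 := by
        have : x * (Complex.exp (θ * Complex.I) + 1) = 0 := by
          have h' : -x * Complex.exp (θ * Complex.I) = x := h
          linear_combination -h'
        exact eq_neg_of_add_eq_zero_left ((mul_eq_zero.1 this).resolve_left hx0)
      have h2 := congrArg Complex.arg h1
      rw [Complex.arg_exp_mul_I, Complex.arg_neg_one, toIocMod_eq_self _ |>.2] at h2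
      · exact hθ.2.ne h2
      · exact ⟨hθ.1, by linarith [hθ.2]⟩
  rw [himage]
  exact isPreconnected_Ioo.image _ (by fun_prop)

theorem IsJordanCurve.isPreconnected_diff_singleton {Γ : Set ℂ} (hΓ : IsJordanCurve Γ) {w : ℂ}
    (hw : w ∈ Γ) : IsPreconnected (Γ \ {w}) := by
  obtain ⟨e, hec, hei, rfl⟩ := hΓ
  obtain ⟨x, hx, rfl⟩ := hw
  have : e '' sphere 0 1 \ {e x} = e '' (sphere 0 1 \ {x}) := by
    rw [hei.image_sdiff_subset (singleton_subset_iff.2 hx), image_singleton]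
  rw [this]
  exact (isPreconnected_sphere_diff_singleton hx).image e (hec.mono sdiff_subset)

theorem extension_injective_of_jordan
    (G : Set ℂ) (hG : IsJordanDomain G)
    (ψ : ℂ → ℂ) (hψd : DifferentiableOn ℂ ψ (Metric.ball (0 : ℂ) 1))
    (hψi : Set.InjOn ψ (Metric.ball (0 : ℂ) 1))
    (hψs : ψ '' Metric.ball (0 : ℂ) 1 = G)
    (Ψ : ℂ → ℂ) (hΨc : ContinuousOn Ψ (Metric.closedBall (0 : ℂ) 1))
    (hΨψ : Set.EqOn Ψ ψ (Metric.ball (0 : ℂ) 1)) :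
    Set.InjOn Ψ (Metric.closedBall (0 : ℂ) 1) := by
  obtain ⟨hGo, -, -, Γ, hΓ, rfl, -⟩ := hG
  have hΨd : DifferentiableOn ℂ Ψ (ball 0 1) := hψd.congr hΨψ
  have hΨi : InjOn Ψ (ball 0 1) := hψi.congr hΨψ.symm
  have hΨs : Ψ '' ball 0 1 = G := hΨψ.image_eq.trans hψs
  have hinj : ∀ x ∈ closedBall (0 : ℂ) 1, ∀ y ∈ ball (0 : ℂ) 1, Ψ x = Ψ y → x = y :=
    fun x hx y hy ↦ eq_of_apply_eq_of_injOn_ball hΨc hΨd hΨi hx hy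
  have hnotball : ∀ ζ : ℂ, ‖ζ‖ = 1 → ζ ∉ ball (0 : ℂ) 1 := fun ζ hζ h ↦ by simp [hζ] at h
  have hclosed : ∀ ζ : ℂ, ‖ζ‖ = 1 → ζ ∈ closedBall (0 : ℂ) 1 := fun ζ hζ ↦ by simp [hζ]
  have hΨG : ∀ z ∈ ball (0 : ℂ) 1, Ψ z ∈ G := fun z hz ↦ hΨs ▸ mem_image_of_mem Ψ hz
  have hfront : ∀ ζ : ℂ, ‖ζ‖ = 1 → Ψ ζ ∈ frontier G := by
    intro ζ hζ
    rw [hGo.frontier_eq]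
    refine ⟨?_, fun hmem ↦ ?_⟩
    · have hcl : ζ ∈ closure (ball (0 : ℂ) 1) := by
        rw [closure_ball _ one_ne_zero]
        exact hclosed ζ hζ
      rw [← hΨs]
      exact ((hΨc ζ (hclosed ζ hζ)).mono ball_subset_closedBall).mem_closure_image hcl
    · rw [← hΨs] at hmem
      obtain ⟨z, hz, hzζ⟩ := hmem
      exact hnotball ζ hζ (hinj ζ (hclosed ζ hζ) z hz hzζ.symm ▸ hz)
  intro a ha b hb hΨab
  by_contra hab
  have ha1 : ‖a‖ = 1 := by
    refine le_antisymm (by simpa using ha) (not_lt.1 fun h ↦ hab ?_)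
    exact (hinj b hb a (by simpa using h) hΨab.symm).symm
  have hb1 : ‖b‖ = 1 := by
    refine le_antisymm (by simpa using hb) (not_lt.1 fun h ↦ hab ?_)
    exact hinj a ha b (by simpa using h) hΨab
  have harc : ∀ p q : ℂ, ‖p‖ = 1 → ‖q‖ = 1 → p ≠ q →
      ∃ ζ : ℂ, ‖ζ‖ = 1 ∧ 0 < chordSide p q ζ ∧ Ψ ζ ≠ Ψ a := by
    intro p q hp hq hpq
    by_contra! hconst
    obtain ⟨ζ₀, hζ₀, hζ₀s⟩ := exists_norm_eq_one_chordSide_pos hp hq hpq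
    have h0 := apply_zero_eq_of_eq_on_arc hΨc hΨd
      (isOpen_lt continuous_const (continuous_chordSide p q)) hζ₀ hζ₀s
      (fun ζ hζ hζ1 ↦ hconst ζ hζ1 hζ)
    have := hinj a ha 0 (mem_ball_self one_pos) h0.symm
    simp [this] at ha1
  obtain ⟨ζ₁, hζ₁, hs₁, hne₁⟩ := harc a b ha1 hb1 hab
  obtain ⟨ζ₂, hζ₂, hs₂, hne₂⟩ := harc b a hb1 ha1 (Ne.symm hab)
  have hsub : ∀ {p q ζ : ℂ}, ‖ζ‖ = 1 →
      insert ζ (ball (0 : ℂ) 1 ∩ {z | 0 < chordSide p q z}) ⊆ closedBall 0 1 := fun hζ ↦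
    insert_subset (hclosed _ hζ) (inter_subset_left.trans ball_subset_closedBall)
  obtain ⟨z₁, hz₁, z₂, hz₂, c₁, c₂, hz₁s, hz₂s, hc, hl₁, hl₂⟩ :=
    exists_hasLogIncrement_ne ha1 hb1 hab hΨc hΨd hinj
  set S₁ := insert ζ₁ (ball (0 : ℂ) 1 ∩ {z | 0 < chordSide a b z})
  set S₂ := insert ζ₂ (ball (0 : ℂ) 1 ∩ {z | 0 < chordSide b a z})
  have hpre₁ : IsPreconnected (Ψ '' S₁) :=
    (isPreconnected_insert_halfDisc hζ₁ hs₁).image Ψ (hΨc.mono (hsub hζ₁))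
  have hpre₂ : IsPreconnected (Ψ '' S₂) :=
    (isPreconnected_insert_halfDisc hζ₂ hs₂).image Ψ (hΨc.mono (hsub hζ₂))
  have hpre : IsPreconnected (Ψ '' S₁ ∪ frontier G \ {Ψ a} ∪ Ψ '' S₂) := by
    refine IsPreconnected.union (Ψ ζ₂) (Or.inr ⟨hfront ζ₂ hζ₂, hne₂⟩)
      (mem_image_of_mem Ψ (mem_insert _ _)) ?_ hpre₂
    exact IsPreconnected.union (Ψ ζ₁) (mem_image_of_mem Ψ (mem_insert _ _))
      ⟨hfront ζ₁ hζ₁, hne₁⟩ hpre₁ (hΓ.isPreconnected_diff_singleton (hfront a ha1))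
  have havoid : ∀ {p q ζ : ℂ}, ‖ζ‖ = 1 → 0 < chordSide p q ζ → Ψ ζ ≠ Ψ a →
      (∀ t : ℝ, chordSide p q (a + t * (b - a)) = 0) → ∀ t ∈ Icc (0 : ℝ) 1,
      Ψ (a + t * (b - a)) ∉ Ψ '' insert ζ (ball (0 : ℂ) 1 ∩ {z | 0 < chordSide p q z}) := by
    rintro p q ζ hζ hsζ hneζ hline t ht ⟨z, hz, hzt⟩
    have hzs : 0 < chordSide p q z := by
      rcases hz with rfl | hz
      exacts [hsζ, hz.2]
    have hzne : z ≠ a + t * (b - a) := fun h ↦ by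
      rw [h, hline t] at hzs
      exact lt_irrefl _ hzs
    by_cases hend : Ψ (a + t * (b - a)) = Ψ a
    · rcases hz with rfl | hz
      · exact hneζ (hzt.trans hend)
      · exact hnotball a ha1 (hinj a ha z hz.1 (hzt.trans hend).symm ▸ hz.1)
    · have ht' : t ∈ Ioo (0 : ℝ) 1 := by
        refine ⟨lt_of_le_of_ne ht.1 ?_, lt_of_le_of_ne ht.2 ?_⟩
        · rintro rfl; exact hend (by simp)
        · rintro rfl; exact hend (by simp [hΨab])
      exact hzne (hinj z (hsub hζ hz) _ (chord_mem_ball ha1 hb1 hab ht') hzt)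
  have hγ : ContinuousOn (fun t : ℝ ↦ Ψ (a + t * (b - a))) (Icc 0 1) :=
    hΨc.comp (by fun_prop) fun t ht ↦ chord_mem_closedBall ha1 hb1 ht
  refine hc (HasLogIncrement.unique (HasLogIncrement.of_isPreconnected hγ (by simp [hΨab]) hpre ?_
    (Or.inl (Or.inl (mem_image_of_mem Ψ (Or.inr ⟨hz₁, hz₁s⟩))))
    (Or.inr (mem_image_of_mem Ψ (Or.inr ⟨hz₂, ?_⟩))) hl₁) hl₂)
  · rintro t ht ((h | h) | h)
    · exact havoid hζ₁ hs₁ hne₁ (chordSide_chord a b) t ht h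
    · rcases eq_or_ne t 0 with rfl | ht0
      · exact h.2 (by simp)
      rcases eq_or_ne t 1 with rfl | ht1
      · exact h.2 (by simp [hΨab])
      have hmem := hΨG _ (chord_mem_ball ha1 hb1 hab
        ⟨lt_of_le_of_ne ht.1 ht0.symm, lt_of_le_of_ne ht.2 ht1⟩)
      rw [hGo.frontier_eq] at h
      exact h.1.2 hmem
    · refine havoid hζ₂ hs₂ hne₂ (fun t ↦ ?_) t ht h
      rw [chordSide_swap, chordSide_chord, neg_zero]
  · rw [mem_ofPred_eq, chordSide_swap]
    linarith
end

section
/- Let G ⊆ ℂ be a simply connected domain whose boundary contains more than one point, let f be a function analytic on G, let c ∈ ℂ, and let E ⊆ ∂G be a nonempty set such that ∂G ∖ E is a Jordan arc. If for each a ∈ E one has f(z) → c as z → a with z ∈ G, then f is constant on G. -/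
/-- `A` is a Jordan arc: the image of an injective continuous map from `[0,1]` into `ℂ`. -/
def IsJordanArc (A : Set ℂ) : Prop :=
  ∃ f : ℝ → ℂ, ContinuousOn f (Set.Icc 0 1) ∧ Set.InjOn f (Set.Icc 0 1) ∧
    A = f '' Set.Icc 0 1

theorem IsJordanArc.isClosed {A : Set ℂ} (hA : IsJordanArc A) : IsClosed A := by
  obtain ⟨f, hf, -, rfl⟩ := hA
  exact (isCompact_Icc.image_of_continuousOn hf).isClosed

/-- On a simply connected open set omitting `a`, there is a holomorphic branch of `√(z - a)`. -/
theorem IsSimplyConnected.exists_differentiableOn_sq_eq_sub {G : Set ℂ} (hGo : IsOpen G)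
    (hG : IsSimplyConnected G) {a : ℂ} (ha : a ∉ G) :
    ∃ s : ℂ → ℂ, DifferentiableOn ℂ s G ∧ ∀ z, s z ^ 2 = z - a := by
  obtain ⟨s, hsc, hs⟩ := Complex.exists_continuousOn_pow_eq hG hGo
    (g := fun z => z - a) (by fun_prop) (by
      rintro ⟨z, hz, h⟩
      exact ha (sub_eq_zero.1 h ▸ hz)) two_ne_zero
  refine ⟨s, fun z hz => ?_, hs⟩
  have hsz : s z ≠ 0 := fun h => ha (by
    have := hs z
    rw [h, zero_pow two_ne_zero, eq_comm, sub_eq_zero] at this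
    exact this ▸ hz)
  have hd : HasDerivAt (fun w : ℂ => w ^ 2 + a) (2 * s z) (s z) := by
    simpa using (hasDerivAt_pow 2 (s z)).add_const a
  exact (hd.of_local_left_inverse (hsc.continuousAt (hGo.mem_nhds hz))
    (mul_ne_zero two_ne_zero hsz)
    (Filter.Eventually.of_forall fun w => by simp [hs w])).differentiableAt.differentiableWithinAt

/-- A continuous branch `s` of `√(z - a)` stays away from `-s z₀`, for each `z₀ ∈ G`. -/
theorem exists_pos_le_norm_add_of_sq_eq_sub {G : Set ℂ} (hGo : IsOpen G) {a : ℂ} (ha : a ∉ G)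
    {s : ℂ → ℂ} (hsc : ContinuousOn s G) (hs : ∀ z, s z ^ 2 = z - a) {z₀ : ℂ} (hz₀ : z₀ ∈ G) :
    ∃ δ > 0, ∀ z, δ ≤ ‖s z + s z₀‖ := by
  have h0 : 0 < ‖s z₀‖ := norm_pos_iff.2 fun h => ha (by
    have := hs z₀
    rw [h, zero_pow two_ne_zero, eq_comm, sub_eq_zero] at this
    exact this ▸ hz₀)
  obtain ⟨r, hr, hball⟩ := Metric.continuousAt_iff.1 (hsc.continuousAt (hGo.mem_nhds hz₀)) _ h0
  refine ⟨min ‖s z₀‖ (r / (4 * ‖s z₀‖)), by positivity, fun z => ?_⟩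
  by_contra! hlt
  obtain ⟨h1, h2⟩ := lt_min_iff.1 hlt
  have hdiff : ‖s z - s z₀‖ ≤ ‖s z + s z₀‖ + 2 * ‖s z₀‖ := by
    calc ‖s z - s z₀‖ = ‖(s z + s z₀) - 2 * s z₀‖ := by ring_nf
      _ ≤ _ := (norm_sub_le _ _).trans (by simp)
  have hprod : ‖z - z₀‖ = ‖s z - s z₀‖ * ‖s z + s z₀‖ := by
    rw [← norm_mul]
    congr 1
    linear_combination hs z₀ - hs z
  rw [lt_div_iff₀ (by positivity)] at h2
  have hnear : dist z z₀ < r := by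
    rw [dist_eq_norm, hprod]
    nlinarith [norm_nonneg (s z + s z₀)]
  have hclose := hball hnear
  rw [dist_eq_norm] at hclose
  have htri : 2 * ‖s z₀‖ ≤ ‖s z + s z₀‖ + ‖s z - s z₀‖ := by
    calc 2 * ‖s z₀‖ = ‖(s z + s z₀) - (s z - s z₀)‖ := by
          rw [add_sub_sub_cancel, ← two_mul, norm_mul, Complex.norm_two]
      _ ≤ _ := norm_sub_le _ _
  linarith

/-- Extension by zero is continuous at every point outside the bad part of the frontier. -/
theorem ContinuousOn.continuousAt_indicator_of_tendsto_frontier {X Y : Type*} [TopologicalSpace X]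
    [TopologicalSpace Y] [Zero Y] {G : Set X} (hGo : IsOpen G) {u : X → Y}
    (hu : ContinuousOn u G) {x : X}
    (hx : x ∈ frontier G → Filter.Tendsto u (nhdsWithin x G) (nhds 0)) :
    ContinuousAt (G.indicator u) x := by
  by_cases hxG : x ∈ G
  · refine (hu.continuousAt (hGo.mem_nhds hxG)).congr ?_
    filter_upwards [hGo.mem_nhds hxG] with y hy
    exact (Set.indicator_of_mem hy u).symm
  by_cases hxc : x ∈ closure G
  · rw [ContinuousAt, Set.indicator_of_notMem hxG, ← nhdsWithin_univ, ← Set.union_compl_self G,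
      nhdsWithin_union, Filter.tendsto_sup]
    refine ⟨(hx (hGo.frontier_eq ▸ ⟨hxc, hxG⟩)).congr' ?_, tendsto_const_nhds.congr' ?_⟩
    · filter_upwards [self_mem_nhdsWithin] with y hy
      exact (Set.indicator_of_mem hy u).symm
    · filter_upwards [self_mem_nhdsWithin] with y hy
      exact (Set.indicator_of_notMem hy u).symm
  · refine (continuousAt_const (y := (0 : Y))).congr ?_
    filter_upwards [isClosed_closure.isOpen_compl.mem_nhds hxc] with y hy
    exact (Set.indicator_of_notMem (fun h => hy (subset_closure h)) u).symm

/-- Maximum principle on `G ∩ ball a ρ` for a function vanishing at the frontier of `G`. -/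
theorem Complex.norm_le_of_tendsto_zero_frontier {G : Set ℂ} (hGo : IsOpen G) {a : ℂ} {ρ C : ℝ}
    {u : ℂ → ℂ} (hu : DifferentiableOn ℂ u G) (hC : 0 ≤ C)
    (hlim : ∀ x ∈ frontier G ∩ Metric.closedBall a ρ,
      Filter.Tendsto u (nhdsWithin x G) (nhds 0))
    (hbd : ∀ z ∈ G ∩ Metric.sphere a ρ, ‖u z‖ ≤ C) {z : ℂ} (hz : z ∈ G ∩ Metric.ball a ρ) :
    ‖u z‖ ≤ C := by
  have hcl : closure (G ∩ Metric.ball a ρ) ⊆ Metric.closedBall a ρ :=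
    (closure_mono Set.inter_subset_right).trans Metric.closure_ball_subset_closedBall
  have hd : DiffContOnCl ℂ (G.indicator u) (G ∩ Metric.ball a ρ) :=
    ⟨(hu.mono Set.inter_subset_left).congr fun w hw => Set.indicator_of_mem hw.1 u,
      fun x hx => (hu.continuousOn.continuousAt_indicator_of_tendsto_frontier hGo
        fun hxf => hlim x ⟨hxf, hcl hx⟩).continuousWithinAt⟩
  have := Complex.norm_le_of_forall_mem_frontier_norm_le
    (Metric.isBounded_ball.subset Set.inter_subset_right) hd (C := C) (fun w hw => ?_)
    (subset_closure hz)
  · rwa [Set.indicator_of_mem hz.1] at this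
  · by_cases hwG : w ∈ G
    · rw [Set.indicator_of_mem hwG]
      refine hbd w ⟨hwG, ?_⟩
      refine (hcl hw.1).antisymm (not_lt.1 fun hlt => ?_)
      exact ((hGo.inter Metric.isOpen_ball).frontier_eq ▸ hw).2 ⟨hwG, hlt⟩
    · simpa [Set.indicator_of_notMem hwG] using hC

/-- A function on a simply connected open set vanishing at the part of the frontier lying in a disc
about a frontier point `a` is zero near `a`. -/
theorem Complex.eq_zero_of_tendsto_zero_frontier_of_mem_ball {G : Set ℂ} (hGo : IsOpen G)
    (hG : IsSimplyConnected G) {a : ℂ} (ha : a ∉ G) {ρ : ℝ} {h : ℂ → ℂ}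
    (hh : DifferentiableOn ℂ h G)
    (hlim : ∀ x ∈ frontier G ∩ Metric.closedBall a ρ,
      Filter.Tendsto h (nhdsWithin x G) (nhds 0))
    {z₀ : ℂ} (hz₀ : z₀ ∈ G) (hz₀ρ : ‖z₀ - a‖ < ρ / 9) : h z₀ = 0 := by
  obtain ⟨s, hsd, hs⟩ := hG.exists_differentiableOn_sq_eq_sub hGo ha
  obtain ⟨δ, hδ, hδle⟩ := exists_pos_le_norm_add_of_sq_eq_sub hGo ha hsd.continuousOn hs hz₀
  have hne : ∀ z, s z + s z₀ ≠ 0 := fun z => norm_pos_iff.1 (hδ.trans_le (hδle z))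
  have hnorm : ∀ z, ‖s z‖ ^ 2 = ‖z - a‖ := fun z => by rw [← norm_pow, hs]
  have hρ : 0 < ρ := by linarith [norm_nonneg (z₀ - a)]
  have h0 : 0 < ‖s z₀‖ := by
    have := hne z₀
    rw [← two_mul] at this
    exact norm_pos_iff.2 (right_ne_zero_of_mul this)
  have hsmall : 3 * ‖s z₀‖ < √ρ := Real.lt_sqrt_of_sq_lt (by rw [mul_pow, hnorm]; linarith)
  set m : ℝ := √ρ - ‖s z₀‖ with hm
  have hm0 : 0 < m := by linarith
  obtain ⟨M, hM⟩ : ∃ M, ∀ z ∈ Metric.closedBall a ρ, ‖G.indicator h z‖ ≤ M :=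
    (isCompact_closedBall a ρ).exists_bound_of_continuousOn fun x hx =>
      (hh.continuousOn.continuousAt_indicator_of_tendsto_frontier hGo
        fun hxf => hlim x ⟨hxf, hx⟩).continuousWithinAt
  have hM0 : 0 ≤ M := (norm_nonneg _).trans (hM a (Metric.mem_closedBall_self hρ.le))
  set g : ℂ → ℂ := fun z => m / (s z + s z₀) with hg
  have hgd : DifferentiableOn ℂ g G := fun z hz =>
    (differentiableWithinAt_const _).div ((hsd z hz).add_const _) (hne z)
  have hgz₀ : 1 < ‖g z₀‖ := by
    rw [hg]
    simp only [norm_div, Complex.norm_real, Real.norm_eq_abs, abs_of_pos hm0, ← two_mul, norm_mul,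
      Complex.norm_two]
    rw [one_lt_div (by positivity)]
    linarith
  have hbound : ∀ n : ℕ, ‖g z₀‖ ^ n * ‖h z₀‖ ≤ M := fun n => by
    rw [← norm_pow, ← norm_mul]
    refine Complex.norm_le_of_tendsto_zero_frontier (a := a) (ρ := ρ)
      (u := fun z => g z ^ n * h z) hGo
      ((hgd.pow n).mul hh) hM0 (fun x hx => ?_) (fun z hz => ?_)
      ⟨hz₀, mem_ball_iff_norm.2 (by linarith)⟩
    · refine Filter.isBoundedUnder_le_mul_tendsto_zero ?_ (hlim x hx)
      refine Filter.isBoundedUnder_of ⟨(m / δ) ^ n, fun z => ?_⟩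
      simp only [Function.comp, hg, norm_pow, norm_div, Complex.norm_real, Real.norm_eq_abs,
        abs_of_pos hm0]
      gcongr
      exact hδle z
    · have hsz : ‖s z‖ = √ρ := by
        rw [← mem_sphere_iff_norm.1 hz.2, ← hnorm, Real.sqrt_sq (norm_nonneg _)]
      have hg1 : ‖g z‖ ≤ 1 := by
        simp only [hg, norm_div, Complex.norm_real, Real.norm_eq_abs, abs_of_pos hm0]
        refine div_le_one_of_le₀ ?_ (norm_nonneg _)
        rw [hm, ← hsz]
        simpa using norm_sub_norm_le (s z) (-s z₀)
      have hMz := hM z (Metric.sphere_subset_closedBall hz.2)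
      rw [Set.indicator_of_mem hz.1] at hMz
      rw [norm_mul, norm_pow]
      exact (mul_le_of_le_one_left (norm_nonneg _)
        (pow_le_one₀ (norm_nonneg _) hg1)).trans hMz
  by_contra hhz
  have hpos : 0 < ‖h z₀‖ := norm_pos_iff.2 hhz
  obtain ⟨n, hn⟩ := pow_unbounded_of_one_lt (M / ‖h z₀‖) hgz₀
  exact absurd (hbound n) (not_le.2 ((div_lt_iff₀ hpos).1 hn))

theorem analytic_constant_of_constant_boundary_limits
    (G : Set ℂ) (hGopen : IsOpen G) (hGconn : IsConnected G)
    (hGsc : SimplyConnectedSpace ↥G) (hGbd : (frontier G).Nontrivial)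
    (f : ℂ → ℂ) (hf : DifferentiableOn ℂ f G) (c : ℂ)
    (E : Set ℂ) (hE : E ⊆ frontier G) (hEne : E.Nonempty)
    (harc : IsJordanArc (frontier G \ E))
    (hlim : ∀ a ∈ E, Filter.Tendsto f (nhdsWithin a G) (nhds c)) :
    ∀ z ∈ G, ∀ w ∈ G, f z = f w := by
  obtain ⟨a, haE⟩ := hEne
  have hafr := hGopen.frontier_eq ▸ hE haE
  obtain ⟨ρ, hρ, hball⟩ := Metric.nhds_basis_closedBall.mem_iff.1
    (harc.isClosed.isOpen_compl.mem_nhds fun h => h.2 haE)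
  have hd : DifferentiableOn ℂ (fun z => f z - c) G := hf.sub_const c
  have hzero : ∀ z ∈ G, ‖z - a‖ < ρ / 9 → f z - c = 0 := fun z hz hza =>
    Complex.eq_zero_of_tendsto_zero_frontier_of_mem_ball hGopen
      hGsc hafr.2 hd (ρ := ρ)
      (fun x hx => by
        have hxE : x ∈ E := by_contra fun h => hball hx.2 ⟨hx.1, h⟩
        simpa using (hlim x hxE).sub_const c) hz hza
  obtain ⟨z₁, hz₁, hz₁a⟩ := Metric.mem_closure_iff.1 hafr.1 (ρ / 9) (by positivity)
  have hEq : Set.EqOn (fun z => f z - c) 0 G :=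
    (hd.analyticOnNhd hGopen).eqOn_zero_of_preconnected_of_eventuallyEq_zero
      hGconn.isPreconnected hz₁ (by
        filter_upwards [hGopen.mem_nhds hz₁,
          Metric.isOpen_ball.mem_nhds (Metric.mem_ball'.2 hz₁a)] with z hz hza
        exact hzero z hz (mem_ball_iff_norm.1 hza))
  intro z hz w hw
  exact (sub_eq_zero.1 (hEq hz)).trans (sub_eq_zero.1 (hEq hw)).symm
end

section
/- Let G ⊆ ℂ be a simply connected domain whose boundary contains more than one point, and let ψ be a univalent analytic map from the open unit disk D onto G. Then for every nondegenerate subarc I of the unit circle there exists a point a ∈ I, not an endpoint of I, such that the radial limit lim_{r→1⁻} ψ(r·a) exists in ℂ. -/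
open MeasureTheory Filter Topology Metric Set

/-- A zero-free holomorphic function on a disk has a holomorphic square root. -/
theorem exists_differentiableOn_sq_eq {f : ℂ → ℂ} {c : ℂ} {R : ℝ}
    (hf : DifferentiableOn ℂ f (ball c R)) (h0 : ∀ z ∈ ball c R, f z ≠ 0) :
    ∃ g : ℂ → ℂ, DifferentiableOn ℂ g (ball c R) ∧ ∀ z ∈ ball c R, g z ^ 2 = f z := by
  rcases (ball c R).eq_empty_or_nonempty with he | hne
  · exact ⟨f, hf, by simp [he]⟩
  have hR : 0 < R := nonempty_ball.1 hne
  have hc : c ∈ ball c R := mem_ball_self hR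
  obtain ⟨F, hF⟩ := ((hf.deriv isOpen_ball).div hf h0).isExactOn_ball
  obtain ⟨w, hw⟩ := IsAlgClosed.exists_pow_nat_eq (f c) (n := 2) two_pos
  have hG : ∀ z ∈ ball c R,
      HasDerivAt (fun z => f z * Complex.exp (-(F z - F c))) 0 z := by
    intro z hz
    have h1 := (hf.differentiableAt (isOpen_ball.mem_nhds hz)).hasDerivAt
    have h2 := ((hF z hz).sub_const (F c)).neg.cexp
    refine (h1.mul h2).congr_deriv ?_
    have := h0 z hz
    simp only [Pi.div_apply]
    field_simp
    ring
  refine ⟨fun z => w * Complex.exp ((F z - F c) / 2), fun z hz => ?_, fun z hz => ?_⟩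
  · exact ((((hF z hz).sub_const (F c)).div_const 2).cexp.const_mul w).differentiableAt
      |>.differentiableWithinAt
  · have h1 := isOpen_ball.is_const_of_deriv_eq_zero (convex_ball c R).isPreconnected
      (fun z hz => (hG z hz).differentiableAt.differentiableWithinAt)
      (fun z hz => (hG z hz).deriv) hz hc
    simp only [sub_self, neg_zero, Complex.exp_zero, mul_one, Complex.exp_neg] at h1
    rw [mul_pow, hw, ← h1, ← Complex.exp_nat_mul]
    have : ((2 : ℕ) : ℂ) * ((F z - F c) / 2) = F z - F c := by push_cast; ring
    rw [this, inv_mul_cancel_right₀ (Complex.exp_ne_zero _)]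

/-- A univalent function on the unit disk omitting a value is a polynomial in the reciprocal of
a bounded zero-free univalent function. -/
theorem exists_bounded_univalent {ψ : ℂ → ℂ} (hd : DifferentiableOn ℂ ψ (ball 0 1))
    (hi : InjOn ψ (ball 0 1)) {w : ℂ} (hw : w ∉ ψ '' ball 0 1) :
    ∃ (h : ℂ → ℂ) (c : ℂ) (C : ℝ), DifferentiableOn ℂ h (ball 0 1) ∧ InjOn h (ball 0 1) ∧
      (∀ z ∈ ball 0 1, h z ≠ 0) ∧ (∀ z ∈ ball 0 1, ‖h z‖ ≤ C) ∧
      ∀ z ∈ ball 0 1, ψ z = ((h z)⁻¹ + c) ^ 2 + w := by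
  have h0 : ∀ z ∈ ball (0 : ℂ) 1, ψ z - w ≠ 0 := fun z hz h =>
    hw ⟨z, hz, sub_eq_zero.1 h⟩
  obtain ⟨g, hg, hsq⟩ := exists_differentiableOn_sq_eq (hd.sub_const w) h0
  have hgi : InjOn g (ball 0 1) := fun x hx y hy hxy => hi hx hy <| by
    have := hsq x hx
    rw [hxy, hsq y hy] at this
    exact (sub_left_inj.1 this).symm
  have hmem : (0 : ℂ) ∈ ball (0 : ℂ) 1 := mem_ball_self one_pos
  have hopen : IsOpen (g '' ball 0 1) := by
    rcases (hg.analyticOnNhd isOpen_ball).is_constant_or_isOpen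
      (convex_ball (0 : ℂ) 1).isPreconnected with ⟨v, hv⟩ | h
    · have h2 : (1 / 2 : ℂ) ∈ ball (0 : ℂ) 1 := by simp; norm_num
      have := hgi hmem h2 ((hv _ hmem).trans (hv _ h2).symm)
      norm_num at this
    · exact h _ subset_rfl isOpen_ball
  obtain ⟨ε, hε, hball⟩ := isOpen_iff.1 hopen (g 0) ⟨0, hmem, rfl⟩
  have hlow : ∀ z ∈ ball (0 : ℂ) 1, ε ≤ ‖g z + g 0‖ := by
    intro z hz
    by_contra! hlt
    have : -g z ∈ ball (g 0) ε := by
      rw [mem_ball, dist_eq_norm, ← norm_neg]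
      simpa [add_comm] using hlt
    obtain ⟨y, hy, hyz⟩ := hball this
    have h1 : y = z := hi hy hz <| by
      have := hsq y hy
      rw [hyz, neg_sq, hsq z hz] at this
      exact (sub_left_inj.1 this).symm
    subst h1
    have h2 : g y = 0 := self_eq_neg.1 hyz
    exact h0 y hy (by rw [← hsq y hy, h2]; simp)
  have hne : ∀ z ∈ ball (0 : ℂ) 1, g z + g 0 ≠ 0 := fun z hz h => by
    have := hlow z hz
    rw [h, norm_zero] at this
    exact hε.not_ge this
  refine ⟨fun z => (g z + g 0)⁻¹, -g 0, ε⁻¹, (hg.add_const _).inv hne, ?_, ?_, ?_, ?_⟩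
  · exact fun x hx y hy hxy => hgi hx hy (add_left_injective _ (inv_injective hxy))
  · exact fun z hz => inv_ne_zero (hne z hz)
  · intro z hz
    rw [norm_inv]
    exact inv_anti₀ hε (hlow z hz)
  · intro z hz
    simp [hsq z hz]

theorem lintegral_sq_norm_deriv_eq_volume_image {h : ℂ → ℂ} {s : Set ℂ} (hs : IsOpen s)
    (hd : DifferentiableOn ℂ h s) (hi : InjOn h s) :
    ∫⁻ z in s, ENNReal.ofReal (‖deriv h z‖ ^ 2) = volume (h '' s) := by
  rw [← lintegral_abs_det_fderiv_eq_addHaar_image volume hs.measurableSet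
    (f' := fun z => (fderiv ℂ h z).restrictScalars ℝ)
    (fun z hz => ((hd.differentiableAt (hs.mem_nhds hz)).hasFDerivAt.restrictScalars
      ℝ).hasFDerivWithinAt) hi]
  congr! 2 with z
  simp [ContinuousLinearMap.det, LinearMap.det_restrictScalars, Algebra.norm_complex_eq,
    Complex.normSq_eq_norm_sq]

theorem norm_ofReal_mul_exp {r : ℝ} (hr : 0 ≤ r) (θ : ℝ) :
    ‖(r : ℂ) * Complex.exp (θ * Complex.I)‖ = r := by
  simp [Complex.norm_exp_ofReal_mul_I, abs_of_nonneg hr]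

theorem ofReal_mul_exp_mem_ball {r : ℝ} (hr : 0 ≤ r) (hr' : r < 1) (θ : ℝ) :
    (r : ℂ) * Complex.exp (θ * Complex.I) ∈ ball (0 : ℂ) 1 := by
  rwa [mem_ball_zero_iff, norm_ofReal_mul_exp hr]

/-- A holomorphic function has a limit along a radius on which its derivative is square
integrable with respect to `r dr`. -/
theorem exists_tendsto_radial_of_lintegral_lt_top {h : ℂ → ℂ}
    (hd : DifferentiableOn ℂ h (ball 0 1)) {θ : ℝ}
    (hfin : ∫⁻ r in Ioo (0 : ℝ) 1, ENNReal.ofReal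
      (r * ‖deriv h (r * Complex.exp (θ * Complex.I))‖ ^ 2) < ⊤) :
    ∃ L, Tendsto (fun r : ℝ => h (r * Complex.exp (θ * Complex.I))) (𝓝[<] 1) (𝓝 L) := by
  set e := Complex.exp (θ * Complex.I) with he
  have hder : ∀ r : ℝ, 0 ≤ r → r < 1 →
      HasDerivAt (fun r : ℝ => h (r * e)) (deriv h (r * e) * e) r := by
    intro r hr hr'
    have h1 := (hd.differentiableAt
      (isOpen_ball.mem_nhds (ofReal_mul_exp_mem_ball hr hr' θ))).hasDerivAt
    have h2 : HasDerivAt (fun r : ℝ => (r : ℂ) * e) e r := by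
      simpa using (Complex.ofRealCLM.hasDerivAt (x := r)).mul_const e
    exact h1.comp r h2
  have hmeas : Measurable fun r : ℝ => deriv h (r * e) * e := by
    have := measurable_deriv h
    fun_prop
  have hint : IntervalIntegrable (fun r : ℝ => deriv h (r * e) * e) volume (1 / 2) 1 := by
    rw [intervalIntegrable_iff_integrableOn_Ioo_of_le (by norm_num)]
    refine ⟨hmeas.aestronglyMeasurable, ?_⟩
    have hb : ∀ r ∈ Ioo (1 / 2 : ℝ) 1, ‖deriv h (r * e) * e‖ₑ ≤
        1 + 2 * ENNReal.ofReal (r * ‖deriv h (r * e)‖ ^ 2) := by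
      intro r hr
      have h1 : ‖deriv h (r * e) * e‖ = ‖deriv h (r * e)‖ := by
        simp [he, Complex.norm_exp_ofReal_mul_I]
      rw [← ofReal_norm, h1, ← ENNReal.ofReal_one, ← ENNReal.ofReal_ofNat 2,
        ← ENNReal.ofReal_mul (by norm_num), ← ENNReal.ofReal_add (by norm_num)
          (mul_nonneg zero_le_two (mul_nonneg (by linarith [hr.1]) (sq_nonneg _)))]
      refine ENNReal.ofReal_le_ofReal ?_
      nlinarith [sq_nonneg (‖deriv h (r * e)‖ - 1), hr.1, sq_nonneg ‖deriv h (r * e)‖,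
        mul_nonneg (sub_nonneg.2 hr.1.le) (sq_nonneg ‖deriv h (r * e)‖)]
    refine (setLIntegral_mono' measurableSet_Ioo hb).trans_lt ?_
    rw [lintegral_add_left measurable_const, lintegral_const_mul' _ _ (by simp)]
    refine ENNReal.add_lt_top.2 ⟨by simp, ENNReal.mul_lt_top (by simp) ?_⟩
    exact (lintegral_mono_set (Ioo_subset_Ioo_left (by norm_num))).trans_lt hfin
  have hcont := intervalIntegral.continuousOn_primitive_interval' hint left_mem_uIcc
  have hle : (1 / 2 : ℝ) ≤ 1 := by norm_num
  rw [uIcc_of_le hle] at hcont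
  have hT : Tendsto (fun r : ℝ => h ((1 / 2 : ℝ) * e) + ∫ t in (1 / 2 : ℝ)..r,
      deriv h (t * e) * e) (𝓝[<] 1)
      (𝓝 (h ((1 / 2 : ℝ) * e) + ∫ t in (1 / 2 : ℝ)..1, deriv h (t * e) * e)) := by
    refine Tendsto.const_add _ ((hcont 1 (right_mem_Icc.2 hle)).mono_left ?_)
    rw [← nhdsWithin_Ioo_eq_nhdsLT (show (1 / 2 : ℝ) < 1 by norm_num)]
    exact nhdsWithin_mono _ Ioo_subset_Icc_self
  refine ⟨_, hT.congr' ?_⟩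
  filter_upwards [Ioo_mem_nhdsLT (show (1 / 2 : ℝ) < 1 by norm_num)] with r hr
  rw [intervalIntegral.integral_eq_sub_of_hasDerivAt (f := fun r : ℝ => h (r * e))]
  · ring
  · intro x hx
    rw [uIcc_of_le hr.1.le] at hx
    exact hder x (by linarith [hx.1]) (hx.2.trans_lt hr.2)
  · refine hint.mono_set ?_
    rw [uIcc_of_le hr.1.le, uIcc_of_le hle]
    exact Icc_subset_Icc_right hr.2.le

/-- If `q` holds almost everywhere on one period, then almost every real number has a translate
by a multiple of the period at which `q` holds. -/
theorem ae_exists_int_of_ae_Ioo {q : ℝ → Prop} {a T : ℝ} (hT : 0 < T)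
    (hq : ∀ᵐ x, x ∈ Ioo a (a + T) → q x) : ∀ᵐ x, ∃ m : ℤ, q (x + m * T) := by
  have h1 : ∀ᵐ x : ℝ, ∀ m : ℤ, x + m * T ∈ Ioo a (a + T) → q (x + m * T) :=
    ae_all_iff.2 fun m =>
      (measurePreserving_add_right volume (m * T : ℝ)).quasiMeasurePreserving.ae hq
  have h2 : ∀ᵐ x : ℝ, ∀ m : ℤ, x + m * T ≠ a :=
    ae_all_iff.2 fun m =>
      (measurePreserving_add_right volume (m * T : ℝ)).quasiMeasurePreserving.ae
        (Measure.ae_ne volume a)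
  filter_upwards [h1, h2] with x hx hx'
  obtain ⟨m, hm, -⟩ := existsUnique_add_zsmul_mem_Ico hT x a
  rw [zsmul_eq_mul] at hm
  have : x + m * T ∈ Ioo a (a + T) := ⟨lt_of_le_of_ne hm.1 (hx' m).symm, hm.2⟩
  exact ⟨m, hx m this⟩

theorem exp_add_int_mul_two_pi_mul_I (θ : ℝ) (m : ℤ) :
    Complex.exp ((θ + m * (2 * Real.pi) : ℝ) * Complex.I) = Complex.exp (θ * Complex.I) := by
  rw [← Complex.exp_periodic.int_mul m (θ * Complex.I)]
  push_cast
  ring_nf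

/-- A univalent function on the unit disk with image of finite area has radial limits almost
everywhere. -/
theorem ae_exists_tendsto_radial {h : ℂ → ℂ} (hd : DifferentiableOn ℂ h (ball 0 1))
    (hi : InjOn h (ball 0 1)) (hvol : volume (h '' ball 0 1) ≠ ⊤) :
    ∀ᵐ θ : ℝ, ∃ L,
      Tendsto (fun r : ℝ => h (r * Complex.exp (θ * Complex.I))) (𝓝[<] 1) (𝓝 L) := by
  set F : ℂ → ENNReal := (ball 0 1).indicator fun z => ENNReal.ofReal (‖deriv h z‖ ^ 2) with hF
  have hFm : Measurable F := by
    refine Measurable.indicator ?_ measurableSet_ball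
    have := measurable_deriv h
    fun_prop
  have hFint : ∫⁻ z, F z ≠ ⊤ := by
    rwa [hF, lintegral_indicator measurableSet_ball,
      lintegral_sq_norm_deriv_eq_volume_image isOpen_ball hd hi]
  rw [← Complex.lintegral_comp_polarCoord_symm, polarCoord_target, Measure.volume_eq_prod,
    ← Measure.prod_restrict] at hFint
  have hGm : Measurable fun p : ℝ × ℝ => ENNReal.ofReal p.1 • F (Complex.polarCoord.symm p) := by
    simp only [Complex.polarCoord_symm_apply, smul_eq_mul]
    fun_prop
  rw [lintegral_prod_symm _ hGm.aemeasurable] at hFint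
  have hae := ae_lt_top hGm.lintegral_prod_left' hFint
  rw [ae_restrict_iff' measurableSet_Ioo] at hae
  have hper := ae_exists_int_of_ae_Ioo (a := -Real.pi) Real.two_pi_pos
    (q := fun θ => ∫⁻ r in Ioo (0 : ℝ) 1, ENNReal.ofReal
      (r * ‖deriv h (r * Complex.exp (θ * Complex.I))‖ ^ 2) < ⊤) (by
    filter_upwards [hae] with θ hθ hmem
    refine lt_of_le_of_lt ?_ (hθ ⟨hmem.1, by linarith [hmem.2]⟩)
    refine le_trans (le_of_eq ?_) (lintegral_mono_set (Ioo_subset_Ioi_self (a := (1 : ℝ))))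
    refine setLIntegral_congr_fun measurableSet_Ioo fun r hr => ?_
    have h1 : Complex.polarCoord.symm (r, θ) = r * Complex.exp (θ * Complex.I) := by
      simp [Complex.exp_mul_I]
    simp only [h1, hF, smul_eq_mul]
    rw [indicator_of_mem (ofReal_mul_exp_mem_ball hr.1.le hr.2 θ), ENNReal.ofReal_mul hr.1.le])
  filter_upwards [hper] with θ ⟨m, hm⟩
  simp only [exp_add_int_mul_two_pi_mul_I] at hm
  exact exists_tendsto_radial_of_lintegral_lt_top hd hm

/-- A bounded holomorphic function on the unit disk whose radial limits vanish almost everywhere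
vanishes at the origin. -/
theorem eq_zero_of_ae_tendsto_radial_zero {f : ℂ → ℂ} (hd : DifferentiableOn ℂ f (ball 0 1))
    {C : ℝ} (hC : ∀ z ∈ ball 0 1, ‖f z‖ ≤ C)
    (h0 : ∀ᵐ θ : ℝ, Tendsto (fun r : ℝ => f (r * Complex.exp (θ * Complex.I))) (𝓝[<] 1) (𝓝 0)) :
    f 0 = 0 := by
  have hev : ∀ᶠ r : ℝ in 𝓝[<] 1, r ∈ Ioo (0 : ℝ) 1 := Ioo_mem_nhdsLT one_pos
  have hlim : Tendsto (fun r : ℝ => ∫ θ in (0 : ℝ)..2 * Real.pi,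
      f (r * Complex.exp (θ * Complex.I))) (𝓝[<] 1) (𝓝 (∫ _ in (0 : ℝ)..2 * Real.pi, (0 : ℂ))) := by
    refine intervalIntegral.tendsto_integral_filter_of_dominated_convergence (fun _ => C) ?_ ?_
      intervalIntegrable_const ?_
    · filter_upwards [hev] with r hr
      refine Continuous.aestronglyMeasurable ?_
      exact hd.continuousOn.comp_continuous (by fun_prop)
        fun θ => ofReal_mul_exp_mem_ball hr.1.le hr.2 θ
    · filter_upwards [hev] with r hr
      exact Eventually.of_forall fun θ _ => hC _ (ofReal_mul_exp_mem_ball hr.1.le hr.2 θ)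
    · filter_upwards [h0] with θ hθ _ using hθ
  have hmean : ∀ᶠ r : ℝ in 𝓝[<] 1, ∫ θ in (0 : ℝ)..2 * Real.pi,
      f (r * Complex.exp (θ * Complex.I)) = (2 * Real.pi) • f 0 := by
    filter_upwards [hev] with r hr
    have h1 : DiffContOnCl ℂ f (ball 0 |r|) := by
      refine (hd.mono ?_).diffContOnCl
      rw [abs_of_pos hr.1]
      exact closure_ball_subset_closedBall.trans (closedBall_subset_ball hr.2)
    rw [← h1.circleAverage, Real.circleAverage_def, smul_inv_smul₀ Real.two_pi_pos.ne']
    simp [circleMap]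
  have := tendsto_nhds_unique (tendsto_const_nhds.congr' (hmean.mono fun _ h => h.symm)) hlim
  simpa [Real.pi_ne_zero] using this

/-- A bounded holomorphic function on the unit disk whose radial limits vanish almost everywhere
on a nontrivial arc vanishes at the origin. -/
theorem eq_zero_of_ae_Ioo_tendsto_radial_zero {f : ℂ → ℂ}
    (hd : DifferentiableOn ℂ f (ball 0 1)) {C : ℝ} (hC : ∀ z ∈ ball 0 1, ‖f z‖ ≤ C)
    {a b : ℝ} (hab : a < b)
    (h0 : ∀ᵐ θ : ℝ, θ ∈ Ioo a b →
      Tendsto (fun r : ℝ => f (r * Complex.exp (θ * Complex.I))) (𝓝[<] 1) (𝓝 0)) :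
    f 0 = 0 := by
  obtain ⟨n, hn⟩ := exists_nat_gt (2 * Real.pi / (b - a))
  have hba : 0 < b - a := sub_pos.2 hab
  have hn0 : (0 : ℝ) < n := (div_pos Real.two_pi_pos hba).trans hn
  have hn0' : 0 < n := by exact_mod_cast hn0
  set T : ℝ := 2 * Real.pi / n with hTdef
  have hT : 0 < T := div_pos Real.two_pi_pos hn0
  have hTn : n * T = 2 * Real.pi := by rw [hTdef]; field_simp
  have hTb : a + T ≤ b := by
    have : T < b - a := by
      rw [hTdef, div_lt_iff₀ hn0]
      rw [div_lt_iff₀ hba] at hn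
      linarith
    linarith
  set P : ℂ → ℂ := fun z => ∏ k ∈ Finset.range n, f (z * Complex.exp ((k * T : ℝ) * Complex.I))
    with hP
  have hmaps : ∀ k : ℕ, MapsTo (fun z : ℂ => z * Complex.exp ((k * T : ℝ) * Complex.I))
      (ball 0 1) (ball 0 1) := fun k z hz => by
    simpa [-Complex.ofReal_mul, Complex.norm_exp_ofReal_mul_I] using hz
  have hPd : DifferentiableOn ℂ P (ball 0 1) :=
    DifferentiableOn.fun_finsetProd fun k _ => hd.comp (by fun_prop) (hmaps k)
  have hC0 : ∀ s : Finset ℕ, ∀ z ∈ ball (0 : ℂ) 1,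
      ‖∏ k ∈ s, f (z * Complex.exp ((k * T : ℝ) * Complex.I))‖ ≤ C ^ s.card := by
    intro s z hz
    rw [norm_prod]
    exact (Finset.prod_le_prod (fun _ _ => norm_nonneg _) fun k _ => hC _ (hmaps k hz)).trans_eq
      (Finset.prod_const C)
  have hPlim : ∀ᵐ θ : ℝ,
      Tendsto (fun r : ℝ => P (r * Complex.exp (θ * Complex.I))) (𝓝[<] 1) (𝓝 0) := by
    filter_upwards [ae_exists_int_of_ae_Ioo hT (h0.mono fun θ hθ hm =>
      hθ ⟨hm.1, hm.2.trans_le hTb⟩)] with θ ⟨m, hm⟩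
    set j : ℕ := (m % n).toNat with hj
    have hnz : (n : ℤ) ≠ 0 := by exact_mod_cast hn0'.ne'
    have hjm : (j : ℤ) = m % n := Int.toNat_of_nonneg (Int.emod_nonneg m hnz)
    have hjn : j ∈ Finset.range n := by
      rw [Finset.mem_range]
      have := Int.emod_lt_of_pos m (show (0 : ℤ) < n by exact_mod_cast hn0')
      omega
    have hexp : Complex.exp (θ * Complex.I) * Complex.exp ((j * T : ℝ) * Complex.I) =
        Complex.exp ((θ + m * T : ℝ) * Complex.I) := by
      have h1 : θ + m * T = θ + j * T + (m / n : ℤ) * (2 * Real.pi) := by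
        have h2 : (m : ℝ) = j + n * (m / n : ℤ) := by
          have := Int.emod_add_mul_ediv m n
          rw [← hjm] at this
          exact_mod_cast this.symm
        rw [← hTn]
        nth_rewrite 1 [h2]
        ring
      rw [h1, exp_add_int_mul_two_pi_mul_I, ← Complex.exp_add]
      push_cast
      ring_nf
    have hb : Tendsto (fun r : ℝ => C ^ ((Finset.range n).erase j).card *
        ‖f (r * Complex.exp ((θ + m * T : ℝ) * Complex.I))‖) (𝓝[<] 1) (𝓝 0) := by
      simpa using hm.norm.const_mul (C ^ ((Finset.range n).erase j).card)
    refine squeeze_zero_norm' ?_ hb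
    filter_upwards [Ioo_mem_nhdsLT (one_pos (α := ℝ))] with r hr
    simp only [hP]
    rw [← Finset.prod_erase_mul _ _ hjn, norm_mul, mul_assoc (r : ℂ), hexp]
    exact mul_le_mul_of_nonneg_right
      (hC0 _ _ (ofReal_mul_exp_mem_ball hr.1.le hr.2 θ)) (norm_nonneg _)
  have h1 := eq_zero_of_ae_tendsto_radial_zero hPd (hC0 _) hPlim
  simpa [hP, hn0'.ne'] using h1

/-- The image of an injective path in the unit circle contains a nontrivial arc. -/
theorem exists_Ioo_exp_mem_image {δ : ℝ → ℂ} (hc : ContinuousOn δ (Icc 0 1))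
    (hi : InjOn δ (Icc 0 1)) (hs : δ '' Icc 0 1 ⊆ sphere 0 1) :
    ∃ a b : ℝ, a < b ∧ ∀ θ ∈ Ioo a b, Complex.exp (θ * Complex.I) ∈ δ '' Icc 0 1 := by
  have hn : ∀ t ∈ Icc (0 : ℝ) 1, ‖δ t‖ = 1 := fun t ht => by
    simpa using hs ⟨t, ht, rfl⟩
  have h0 : (0 : ℝ) ∈ Icc (0 : ℝ) 1 := by simp
  have hδ0 : δ 0 ≠ 0 := fun h => by simpa [h] using hn 0 h0
  have hq : ContinuousOn (fun t => δ t / δ 0) (Icc 0 1) := hc.div_const _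
  have hev : ∀ᶠ t in 𝓝[Icc 0 1] (0 : ℝ), δ t / δ 0 ∈ Complex.slitPlane :=
    (hq 0 h0).eventually_mem (Complex.isOpen_slitPlane.mem_nhds (by simp [hδ0]))
  rw [nhdsWithin_Icc_eq_nhdsGE one_pos] at hev
  obtain ⟨η, hη, hsub⟩ := mem_nhdsGE_iff_exists_Icc_subset.1
    (hev.and (Icc_mem_nhdsGE (one_pos (α := ℝ))))
  have hη0 : 0 < η := hη
  have hIcc : Icc 0 η ⊆ Icc (0 : ℝ) 1 := fun t ht => (hsub ht).2
  set φ : ℝ → ℝ := fun t => (δ t / δ 0).arg with hφ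
  have hφc : ContinuousOn φ (Icc 0 η) := fun t ht =>
    (Complex.continuousAt_arg (hsub ht).1).comp_continuousWithinAt (f := fun t => δ t / δ 0)
      ((hq t (hIcc ht)).mono hIcc)
  have hexp : ∀ t ∈ Icc 0 η, Complex.exp ((φ t + (δ 0).arg : ℝ) * Complex.I) = δ t := by
    intro t ht
    have h1 := Complex.norm_mul_exp_arg_mul_I (δ t / δ 0)
    have h2 := Complex.norm_mul_exp_arg_mul_I (δ 0)
    rw [norm_div, hn t (hIcc ht), hn 0 h0] at h1
    rw [hn 0 h0] at h2
    push_cast at h1 h2 ⊢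
    rw [add_mul, Complex.exp_add]
    rw [div_one, one_mul] at h1
    rw [one_mul] at h2
    rw [h1, h2, div_mul_cancel₀ _ hδ0]
  have h0η : (0 : ℝ) ∈ Icc 0 η := left_mem_Icc.2 hη0.le
  have hηη : η ∈ Icc 0 η := right_mem_Icc.2 hη0.le
  have hne : φ 0 ≠ φ η := fun h => hη0.ne <| hi h0 (hIcc hηη) <| by
    rw [← hexp 0 h0η, ← hexp η hηη, h]
  have hivt : uIcc (φ 0) (φ η) ⊆ φ '' Icc 0 η := by
    have := intermediate_value_uIcc (a := 0) (b := η) (f := φ) (by rwa [uIcc_of_le hη0.le])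
    rwa [uIcc_of_le hη0.le] at this
  refine ⟨min (φ 0) (φ η) + (δ 0).arg, max (φ 0) (φ η) + (δ 0).arg, ?_, fun θ hθ => ?_⟩
  · have := min_lt_max.2 hne
    linarith
  · obtain ⟨t, ht, hφt⟩ := hivt (show θ - (δ 0).arg ∈ uIcc (φ 0) (φ η) from
      ⟨by linarith [hθ.1], by linarith [hθ.2]⟩)
    exact ⟨t, hIcc ht, by rw [← hexp t ht, hφt, sub_add_cancel]⟩

theorem ae_exp_mul_I_ne (w : ℂ) : ∀ᵐ θ : ℝ, Complex.exp (θ * Complex.I) ≠ w := by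
  have h := ae_exists_int_of_ae_Ioo (a := -Real.pi) Real.two_pi_pos
    (q := fun θ => Complex.exp (θ * Complex.I) ≠ w) (by
      filter_upwards [Measure.ae_ne volume w.arg] with θ hθ hmem hw
      refine hθ ?_
      rw [← hw, Complex.arg_exp_mul_I, eq_comm, toIocMod_eq_self]
      exact ⟨hmem.1, hmem.2.le⟩)
  filter_upwards [h] with θ ⟨m, hm⟩
  rwa [exp_add_int_mul_two_pi_mul_I] at hm

theorem exists_radial_limit_in_subarc
    (G : Set ℂ) (hGopen : IsOpen G) (hGconn : IsConnected G)
    (hGsc : SimplyConnectedSpace ↥G) (hGbd : (frontier G).Nontrivial)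
    (ψ : ℂ → ℂ) (hψd : DifferentiableOn ℂ ψ (Metric.ball (0 : ℂ) 1))
    (hψi : Set.InjOn ψ (Metric.ball (0 : ℂ) 1))
    (hψs : ψ '' Metric.ball (0 : ℂ) 1 = G)
    (δ : ℝ → ℂ) (hδc : ContinuousOn δ (Set.Icc 0 1))
    (hδi : Set.InjOn δ (Set.Icc 0 1))
    (hδs : δ '' Set.Icc 0 1 ⊆ Metric.sphere (0 : ℂ) 1) :
    ∃ a ∈ δ '' Set.Icc 0 1, a ≠ δ 0 ∧ a ≠ δ 1 ∧
      ∃ L : ℂ, Filter.Tendsto (fun r : ℝ => ψ ((r : ℂ) * a))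
        (nhdsWithin 1 (Set.Iio 1)) (nhds L) := by
  obtain ⟨w, hw⟩ := hGbd.nonempty
  rw [hGopen.frontier_eq, ← hψs] at hw
  obtain ⟨h, c, C, hd, hi, hne, hC, hψ⟩ := exists_bounded_univalent hψd hψi hw.2
  have hvol : volume (h '' ball 0 1) ≠ ⊤ := by
    refine ((measure_mono ?_).trans_lt (measure_closedBall_lt_top (x := (0 : ℂ)) (r := C))).ne
    rintro _ ⟨z, hz, rfl⟩
    simpa using hC z hz
  obtain ⟨a, b, hab, hmem⟩ := exists_Ioo_exp_mem_image hδc hδi hδs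
  by_contra hcon
  refine hne 0 (mem_ball_self one_pos) (eq_zero_of_ae_Ioo_tendsto_radial_zero hd hC hab ?_)
  filter_upwards [ae_exists_tendsto_radial hd hi hvol, ae_exp_mul_I_ne (δ 0),
    ae_exp_mul_I_ne (δ 1)] with θ ⟨L, hL⟩ h0 h1 hθ
  rcases eq_or_ne L 0 with rfl | hL0
  · exact hL
  · refine absurd ⟨_, hmem θ hθ, h0, h1, (L⁻¹ + c) ^ 2 + w, ?_⟩ hcon
    refine ((((hL.inv₀ hL0).add_const c).pow 2).add_const w).congr' ?_
    filter_upwards [Ioo_mem_nhdsLT (one_pos (α := ℝ))] with r hr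
    exact (hψ _ (ofReal_mul_exp_mem_ball hr.1.le hr.2 θ)).symm
end

section
/- Let G ⊆ ℂ be a simply connected domain whose boundary contains more than one point, let ψ be a univalent analytic map from the open unit disk D onto G, and let φ : G → D be its inverse. Let λ ∈ ∂G be accessible via a continuous injective map γ : [0,1] → ℂ with γ([0,1)) ⊆ G and γ(1) = λ. Then the limit lim_{t→1⁻} φ(γ(t)) exists and lies on the unit circle. -/
open Set Filter Topology MeasureTheory Metric

theorem nhds_le_map_nhds_of_injOn {f : ℂ → ℂ} {U : Set ℂ} (hU : IsOpen U)
    (hd : DifferentiableOn ℂ f U) (hi : InjOn f U) {z : ℂ} (hz : z ∈ U) :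
    𝓝 (f z) ≤ map f (𝓝 z) := by
  refine (hd.analyticAt (hU.mem_nhds hz)).eventually_constant_or_nhds_le_map_nhds.resolve_left
    fun h => ?_
  have h' : ∀ᶠ w in 𝓝[≠] z, f w = f z ∧ w ∈ U :=
    (h.and (hU.mem_nhds hz)).filter_mono inf_le_left
  obtain ⟨w, ⟨hw, hwU⟩, hwz⟩ := (h'.and self_mem_nhdsWithin).exists
  exact hwz (hi hwU hz hw)

theorem exists_sqrt_of_ne_zero {g : ℂ → ℂ} (hg : DifferentiableOn ℂ g (ball 0 1))
    (h0 : ∀ z ∈ ball (0 : ℂ) 1, g z ≠ 0) :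
    ∃ h : ℂ → ℂ, DifferentiableOn ℂ h (ball 0 1) ∧ ∀ z ∈ ball (0 : ℂ) 1, h z ^ 2 = g z := by
  have hd : DifferentiableOn ℂ (fun z => deriv g z / g z) (ball 0 1) :=
    (hg.deriv isOpen_ball).div hg h0
  obtain ⟨L, hL0, hL⟩ := hd.isExactOn_ball.with_val_at 0 (Complex.log (g 0))
  have hmem : (0 : ℂ) ∈ ball (0 : ℂ) 1 := mem_ball_self one_pos
  have hgd : ∀ z ∈ ball (0 : ℂ) 1, HasDerivAt g (deriv g z) z := fun z hz =>
    (hg.differentiableAt (isOpen_ball.mem_nhds hz)).hasDerivAt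
  have hexp : ∀ z ∈ ball (0 : ℂ) 1, HasDerivAt (fun z => g z * Complex.exp (-L z)) 0 z := by
    intro z hz
    have := (hgd z hz).mul (hL z hz).neg.cexp
    convert! this using 1
    field_simp [h0 z hz]
    ring
  have hconst : ∀ z ∈ ball (0 : ℂ) 1, g z * Complex.exp (-L z) = g 0 * Complex.exp (-L 0) := by
    intro z hz
    refine isOpen_ball.is_const_of_deriv_eq_zero (convex_ball (0 : ℂ) 1).isPreconnected
      (fun w hw => (hexp w hw).differentiableAt.differentiableWithinAt)
      (fun w hw => (hexp w hw).deriv) hz hmem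
  refine ⟨fun z => Complex.exp (L z / 2), fun z hz =>
    ((hL z hz).div_const 2).cexp.differentiableAt.differentiableWithinAt, fun z hz => ?_⟩
  have := hconst z hz
  rw [hL0, Complex.exp_neg (Complex.log _), Complex.exp_log (h0 0 hmem),
    mul_inv_cancel₀ (h0 0 hmem), Complex.exp_neg] at this
  rw [← Complex.exp_nat_mul, Nat.cast_ofNat, mul_div_cancel₀ _ two_ne_zero]
  exact ((mul_inv_eq_one₀ (Complex.exp_ne_zero _)).1 this).symm

theorem exists_bounded_injOn_of_omits {ψ : ℂ → ℂ} (hψ : DifferentiableOn ℂ ψ (ball 0 1))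
    (hi : InjOn ψ (ball 0 1)) {c : ℂ} (hc : ∀ z ∈ ball (0 : ℂ) 1, ψ z ≠ c) :
    ∃ f : ℂ → ℂ, DifferentiableOn ℂ f (ball 0 1) ∧ InjOn f (ball 0 1) ∧ f 0 ≠ 0 ∧
      (∃ M, ∀ z ∈ ball (0 : ℂ) 1, ‖f z‖ ≤ M) ∧
      ∃ C, ∀ z ∈ ball (0 : ℂ) 1, ‖f z‖ ^ 2 ≤ C * ‖ψ z - c‖ := by
  obtain ⟨h, hd, hsq⟩ := exists_sqrt_of_ne_zero (hψ.sub_const c)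
    (fun z hz => sub_ne_zero.2 (hc z hz))
  have hmem : (0 : ℂ) ∈ ball (0 : ℂ) 1 := mem_ball_self one_pos
  have hne : ∀ z ∈ ball (0 : ℂ) 1, h z ≠ 0 := fun z hz h0 =>
    hc z hz (sub_eq_zero.1 (by rw [← hsq z hz, h0]; ring))
  have hinj : ∀ z ∈ ball (0 : ℂ) 1, ∀ w ∈ ball (0 : ℂ) 1, h z ^ 2 = h w ^ 2 → z = w :=
    fun z hz w hw e => hi hz hw (by simpa [hsq z hz, hsq w hw] using e)
  have hopen : h '' ball 0 1 ∈ 𝓝 (h 0) :=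
    nhds_le_map_nhds_of_injOn isOpen_ball hd
      (fun z hz w hw e => hinj z hz w hw (by rw [e])) hmem (image_mem_map (isOpen_ball.mem_nhds hmem))
  obtain ⟨ε, hε, hball⟩ := Metric.mem_nhds_iff.1 hopen
  have hlow : ∀ z ∈ ball (0 : ℂ) 1, ε ≤ ‖h z + h 0‖ := by
    intro z hz
    by_contra! hlt
    have : -h z ∈ ball (h 0) ε := by
      rwa [mem_ball, dist_eq_norm, ← norm_neg, show -(-h z - h 0) = h z + h 0 by ring]
    obtain ⟨w, hw, hwz⟩ := hball this
    obtain rfl := hinj z hz w hw (by rw [hwz]; ring)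
    exact hne z hz (self_eq_neg.1 hwz)
  have hden : ∀ z ∈ ball (0 : ℂ) 1, h z + h 0 ≠ 0 := fun z hz =>
    norm_pos_iff.1 (hε.trans_le (hlow z hz))
  refine ⟨fun z => h z / (h z + h 0), hd.div (hd.add_const _) hden, ?_, ?_, ?_, ?_⟩
  · intro z hz w hw e
    have e : h z / (h z + h 0) = h w / (h w + h 0) := e
    rw [div_eq_div_iff (hden z hz) (hden w hw)] at e
    have : h z = h w := mul_right_cancel₀ (hne 0 hmem) (by linear_combination e)
    exact hinj z hz w hw (by rw [this])
  · exact div_ne_zero (hne 0 hmem) (hden 0 hmem)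
  · refine ⟨1 + ‖h 0‖ / ε, fun z hz => ?_⟩
    have : h z / (h z + h 0) = 1 - h 0 / (h z + h 0) := by
      field_simp [hden z hz]
      ring
    simp only [this]
    refine (norm_sub_le _ _).trans ?_
    rw [norm_one, norm_div]
    gcongr
    exact hlow z hz
  · refine ⟨(ε ^ 2)⁻¹, fun z hz => ?_⟩
    rw [← hsq z hz, norm_pow, norm_div, div_pow, div_eq_inv_mul]
    gcongr
    exact hlow z hz

theorem lintegral_enorm_deriv_lt_top {f : ℂ → ℂ} (hd : DifferentiableOn ℂ f (ball 0 1))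
    (hi : InjOn f (ball 0 1)) {M : ℝ} (hM : ∀ z ∈ ball (0 : ℂ) 1, ‖f z‖ ≤ M) :
    ∫⁻ z in ball (0 : ℂ) 1, ‖deriv f z‖ₑ < ⊤ := by
  have key := lintegral_abs_det_fderiv_eq_addHaar_image volume (measurableSet_ball (x := (0 : ℂ)) (ε := 1))
    (f := f) (f' := fun z => (fderiv ℂ f z).restrictScalars ℝ)
    (fun z hz => ((hd.differentiableAt (isOpen_ball.mem_nhds hz)).hasFDerivAt.restrictScalars ℝ).hasFDerivWithinAt) hi
  have hdet : ∀ z, ENNReal.ofReal |((fderiv ℂ f z).restrictScalars ℝ).det| = ‖deriv f z‖ₑ ^ 2 := by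
    intro z
    have : ((fderiv ℂ f z).restrictScalars ℝ).det = ‖deriv f z‖ ^ 2 := by
      simp [ContinuousLinearMap.det, LinearMap.det_restrictScalars,
        Algebra.norm_complex_eq, Complex.normSq_eq_norm_sq]
    rw [this, abs_of_nonneg (by positivity), ENNReal.ofReal_pow (norm_nonneg _), ofReal_norm]
  simp_rw [hdet] at key
  have himg : volume (f '' ball 0 1) < ⊤ := by
    refine (measure_mono ?_).trans_lt (measure_closedBall_lt_top (x := (0 : ℂ)) (r := M))
    rintro _ ⟨z, hz, rfl⟩
    simpa using hM z hz
  have hle : ∀ x : ENNReal, x ≤ 1 + x ^ 2 := by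
    intro x
    rcases le_total x 1 with h | h
    · exact h.trans le_self_add
    · exact (le_self_pow₀ h two_ne_zero).trans le_add_self
  calc ∫⁻ z in ball (0 : ℂ) 1, ‖deriv f z‖ₑ
      ≤ ∫⁻ z in ball (0 : ℂ) 1, (1 + ‖deriv f z‖ₑ ^ 2) := lintegral_mono fun z => hle _
    _ = volume (ball (0 : ℂ) 1) + volume (f '' ball 0 1) := by
        rw [lintegral_add_left measurable_const, key]; simp
    _ < ⊤ := ENNReal.add_lt_top.2 ⟨measure_ball_lt_top, himg⟩

theorem frequently_arg_eq_of_mapClusterPt {Γ : ℝ → ℂ} (hΓ : ContinuousOn Γ (Ico 0 1))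
    (hs : ∀ᶠ t in 𝓝[<] (1 : ℝ), Γ t ∈ Complex.slitPlane) {a b : ℂ}
    (ha : MapClusterPt a (𝓝[<] (1 : ℝ)) Γ) (hb : MapClusterPt b (𝓝[<] (1 : ℝ)) Γ)
    (has : a ∈ Complex.slitPlane) (hbs : b ∈ Complex.slitPlane) {θ : ℝ}
    (haθ : a.arg < θ) (hθb : θ < b.arg) :
    ∃ᶠ t in 𝓝[<] (1 : ℝ), (Γ t).arg = θ := by
  intro hne
  obtain ⟨c, hc, hcs⟩ := (mem_nhdsLT_iff_exists_Ioo_subset' (show (0 : ℝ) < 1 from one_pos)).1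
    (inter_mem (inter_mem hs hne) (Ioo_mem_nhdsLT (show (0 : ℝ) < 1 from one_pos)))
  have hcont : ContinuousOn (fun t => (Γ t).arg) (Ioo c 1) := fun t ht =>
    (Complex.continuousAt_arg (hcs ht).1.1).comp_continuousWithinAt
      ((hΓ t ⟨(hcs ht).2.1.le, ht.2⟩).mono fun s hs => ⟨(hcs hs).2.1.le, hs.2⟩)
  have hIoo : Ioo c 1 ∈ 𝓝[<] (1 : ℝ) := Ioo_mem_nhdsLT hc
  obtain ⟨s, hs1, hs2⟩ := ((ha.frequently
    ((Complex.continuousAt_arg has).eventually (Iio_mem_nhds haθ))).and_eventually hIoo).exists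
  obtain ⟨t, ht1, ht2⟩ := ((hb.frequently
    ((Complex.continuousAt_arg hbs).eventually (Ioi_mem_nhds hθb))).and_eventually hIoo).exists
  obtain ⟨x, hx, hxθ⟩ := isPreconnected_Ioo.intermediate_value hs2 ht2 hcont ⟨hs1.le, ht1.le⟩
  exact (hcs hx).1.2 hxθ

theorem mul_mem_slitPlane_of_arg_ne {z : ℂ} (hz : z ≠ 0) {θ : ℝ} (hθ : θ ∈ Ioc (-Real.pi) Real.pi)
    (h : z.arg ≠ θ) : Complex.exp ((Real.pi - θ : ℝ) * Complex.I) * z ∈ Complex.slitPlane := by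
  rw [Complex.mem_slitPlane_iff_arg]
  refine ⟨fun hπ => h ?_, mul_ne_zero (Complex.exp_ne_zero _) hz⟩
  have h1 := Complex.norm_mul_exp_arg_mul_I (Complex.exp ((Real.pi - θ : ℝ) * Complex.I) * z)
  rw [hπ, norm_mul, Complex.norm_exp_ofReal_mul_I, one_mul] at h1
  have h2 : z = ‖z‖ * Complex.exp (θ * Complex.I) := by
    have : Complex.exp (Real.pi * Complex.I) =
        Complex.exp ((Real.pi - θ : ℝ) * Complex.I) * Complex.exp (θ * Complex.I) := by
      rw [← Complex.exp_add]; congr 1; push_cast; ring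
    rw [this] at h1
    exact mul_left_cancel₀ (Complex.exp_ne_zero ((Real.pi - θ : ℝ) * Complex.I))
      (by rw [← h1]; ring)
  rw [h2, Complex.exp_mul_I, Complex.arg_mul_cos_add_sin_mul_I (norm_pos_iff.2 hz) hθ]

theorem exists_rotation_frequently_arg_eq {Γ : ℝ → ℂ} (hΓ : ContinuousOn Γ (Ico 0 1))
    (hs : ∀ᶠ t in 𝓝[<] (1 : ℝ), Γ t ≠ 0) {a b : ℂ}
    (ha : MapClusterPt a (𝓝[<] (1 : ℝ)) Γ) (hb : MapClusterPt b (𝓝[<] (1 : ℝ)) Γ)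
    (ha1 : ‖a‖ = 1) (hb1 : ‖b‖ = 1) (hab : a ≠ b) :
    ∃ u : ℂ, ‖u‖ = 1 ∧ ∃ α β : ℝ, α < β ∧ -Real.pi ≤ α ∧ β ≤ Real.pi ∧
      ∀ θ ∈ Ioo α β, ∃ᶠ t in 𝓝[<] (1 : ℝ), (u * Γ t).arg = θ := by
  wlog hlt : a.arg < b.arg generalizing a b
  · refine this hb ha hb1 ha1 hab.symm (lt_of_le_of_ne (not_lt.1 hlt) fun e => hab ?_)
    exact Complex.ext_norm_arg (ha1.trans hb1.symm) e.symm
  by_cases hall : ∀ θ ∈ Ioo a.arg b.arg, ∃ᶠ t in 𝓝[<] (1 : ℝ), (Γ t).arg = θ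
  · exact ⟨1, norm_one, a.arg, b.arg, hlt, (Complex.neg_pi_lt_arg a).le, Complex.arg_le_pi b,
      by simpa using hall⟩
  push Not at hall
  obtain ⟨θ, hθ, hev⟩ := hall
  have hθπ : θ ∈ Ioc (-Real.pi) Real.pi :=
    ⟨(Complex.neg_pi_lt_arg a).trans hθ.1, hθ.2.le.trans (Complex.arg_le_pi b)⟩
  set u := Complex.exp ((Real.pi - θ : ℝ) * Complex.I) with hu
  have hu1 : ‖u‖ = 1 := Complex.norm_exp_ofReal_mul_I _
  have hmc : ∀ c, MapClusterPt c (𝓝[<] (1 : ℝ)) Γ →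
      MapClusterPt (u * c) (𝓝[<] (1 : ℝ)) (fun t => u * Γ t) := fun c hc =>
    hc.continuousAt_comp (f := fun z => u * z) (by fun_prop)
  have hsl : ∀ᶠ t in 𝓝[<] (1 : ℝ), u * Γ t ∈ Complex.slitPlane := by
    filter_upwards [hs, hev] with t h1 h2 using mul_mem_slitPlane_of_arg_ne h1 hθπ h2
  have has : u * a ∈ Complex.slitPlane :=
    mul_mem_slitPlane_of_arg_ne (norm_ne_zero_iff.1 (by simp [ha1])) hθπ hθ.1.ne
  have hbs : u * b ∈ Complex.slitPlane :=
    mul_mem_slitPlane_of_arg_ne (norm_ne_zero_iff.1 (by simp [hb1])) hθπ hθ.2.ne'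
  have hne : (u * a).arg ≠ (u * b).arg := fun e => hab <|
    mul_left_cancel₀ (Complex.exp_ne_zero _)
      (Complex.ext_norm_arg (by simp [ha1, hb1]) e : u * a = u * b)
  have hc : ContinuousOn (fun t => u * Γ t) (Ico 0 1) := continuousOn_const.mul hΓ
  rcases lt_or_gt_of_ne hne with h | h
  · exact ⟨u, hu1, _, _, h, (Complex.neg_pi_lt_arg _).le, Complex.arg_le_pi _, fun x hx =>
      frequently_arg_eq_of_mapClusterPt hc hsl (hmc a ha) (hmc b hb) has hbs hx.1 hx.2⟩
  · exact ⟨u, hu1, _, _, h, (Complex.neg_pi_lt_arg _).le, Complex.arg_le_pi _, fun x hx =>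
      frequently_arg_eq_of_mapClusterPt hc hsl (hmc b hb) (hmc a ha) hbs has hx.1 hx.2⟩

theorem circleMap_mem_ball_one {r θ : ℝ} (h0 : 0 ≤ r) (h1 : r < 1) :
    circleMap 0 r θ ∈ ball (0 : ℂ) 1 := by
  simpa [abs_of_nonneg h0] using h1

theorem norm_pow_le_integral_arc {f : ℂ → ℂ} (hd : DifferentiableOn ℂ f (ball 0 1))
    {M : ℝ} (hM : ∀ z ∈ ball (0 : ℂ) 1, ‖f z‖ ≤ M) (n : ℕ) (α : ℝ) {r : ℝ} (hr0 : 0 < r)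
    (hr1 : r < 1) :
    ‖f 0‖ ^ (n + 1) ≤ (2 * Real.pi)⁻¹ * ((n + 1) * (M ^ n *
      ∫ θ in α..α + 2 * Real.pi / (n + 1), ‖f (circleMap 0 r θ)‖)) := by
  set δ : ℝ := 2 * Real.pi / (n + 1) with hδ
  have hδ0 : 0 < δ := by positivity
  have hnδ : (n + 1 : ℝ) * δ = 2 * Real.pi := by rw [hδ]; field_simp
  set q : ℝ → ℝ := fun θ => ‖f (circleMap 0 r θ)‖ with hq
  have hqc : Continuous q := by
    refine (hd.continuousOn.comp_continuous (continuous_circleMap 0 r) fun θ =>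
      circleMap_mem_ball_one hr0.le hr1).norm
  have hqM : ∀ θ, q θ ≤ M := fun θ => hM _ (circleMap_mem_ball_one hr0.le hr1)
  have hqp : Function.Periodic q (2 * Real.pi) := fun θ => by
    simp only [hq, periodic_circleMap 0 r θ]
  set P : ℝ → ℝ := fun θ => ∏ k ∈ Finset.range (n + 1), q (θ + k * δ) with hP
  have hPc : Continuous P := by fun_prop
  have hPp : Function.Periodic P δ := by
    intro θ
    simp only [hP]
    rw [Finset.prod_range_succ, Finset.prod_range_succ']
    congr 1
    · refine Finset.prod_congr rfl fun k _ => ?_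
      congr 1; push_cast; ring
    · rw [show θ + δ + n * δ = θ + 2 * Real.pi by rw [← hnδ]; ring, hqp]
      simp
  set F : ℂ → ℂ := fun z => ∏ k ∈ Finset.range (n + 1),
    f (Complex.exp ((k * δ : ℝ) * Complex.I) * z) with hF
  have hrot : ∀ (x : ℝ) (z : ℂ), ‖Complex.exp (x * Complex.I) * z‖ = ‖z‖ := fun x z => by
    rw [norm_mul, Complex.norm_exp_ofReal_mul_I, one_mul]
  have hFd : DifferentiableOn ℂ F (ball 0 1) := by
    refine DifferentiableOn.fun_finsetProd fun k _ => ?_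
    refine hd.comp (by fun_prop) fun z hz => ?_
    rw [mem_ball_zero_iff] at hz ⊢
    rwa [hrot]
  have hmean : Real.circleAverage F 0 r = F 0 := by
    refine DiffContOnCl.circleAverage (DifferentiableOn.diffContOnCl (hFd.mono ?_))
    rw [abs_of_pos hr0, closure_ball _ hr0.ne']
    exact closedBall_subset_ball hr1
  have hF0 : F 0 = f 0 ^ (n + 1) := by simp [hF]
  have hFP : ∀ θ, ‖F (circleMap 0 r θ)‖ = P θ := by
    intro θ
    simp only [hF, hP, norm_prod, hq]
    refine Finset.prod_congr rfl fun k _ => ?_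
    congr 2
    rw [circleMap_zero, circleMap_zero, mul_left_comm, ← Complex.exp_add]
    congr 2
    push_cast; ring
  have hPle : ∀ θ, P θ ≤ M ^ n * q θ := by
    intro θ
    simp only [hP]
    rw [Finset.prod_range_succ']
    simp only [Nat.cast_zero, zero_mul, add_zero]
    refine mul_le_mul_of_nonneg_right ?_ (norm_nonneg _)
    refine (Finset.prod_le_prod (fun k _ => norm_nonneg _) fun k _ => hqM _).trans ?_
    simp
  rw [← norm_pow, ← hF0, ← hmean, Real.circleAverage_def, norm_smul, Real.norm_of_nonneg (by positivity)]
  gcongr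
  refine (intervalIntegral.norm_integral_le_integral_norm (by positivity)).trans ?_
  simp_rw [hFP]
  have h1 := hPp.intervalIntegral_add_zsmul_eq (n + 1 : ℤ) 0
    (fun a b => hPc.intervalIntegrable a b)
  rw [zsmul_eq_mul, zsmul_eq_mul] at h1
  push_cast at h1
  rw [hnδ, hPp.intervalIntegral_add_eq 0 α, zero_add] at h1
  rw [h1, ← intervalIntegral.integral_const_mul (M ^ n)]
  refine mul_le_mul_of_nonneg_left ?_ (by positivity)
  exact intervalIntegral.integral_mono_on (by linarith) (hPc.intervalIntegrable _ _)
    ((hqc.const_mul _).intervalIntegrable _ _) fun θ _ => hPle θ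

theorem lintegral_enorm_deriv_polar_lt_top {f : ℂ → ℂ}
    (hf : ∫⁻ z in ball (0 : ℂ) 1, ‖deriv f z‖ₑ < ⊤) {α β : ℝ} (hα : -Real.pi ≤ α)
    (hβ : β ≤ Real.pi) :
    ∫⁻ p in Ioo (1 / 2 : ℝ) 1 ×ˢ Ioo α β, ‖deriv f (circleMap 0 p.1 p.2)‖ₑ < ⊤ := by
  rw [← lintegral_indicator measurableSet_ball, ← Complex.lintegral_comp_polarCoord_symm] at hf
  have hsymm : ∀ p : ℝ × ℝ, Complex.polarCoord.symm p = circleMap 0 p.1 p.2 := fun p => by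
    rw [Complex.polarCoord_symm_apply, circleMap_zero, Complex.exp_mul_I]; simp
  have hS : MeasurableSet (Ioo (1 / 2 : ℝ) 1 ×ˢ Ioo α β) := measurableSet_Ioo.prod measurableSet_Ioo
  calc _ ≤ ∫⁻ p in Ioo (1 / 2 : ℝ) 1 ×ˢ Ioo α β, 2 * (ENNReal.ofReal p.1 •
        (ball (0 : ℂ) 1).indicator (fun z => ‖deriv f z‖ₑ) (Complex.polarCoord.symm p)) := by
        refine setLIntegral_mono' hS fun p hp => ?_
        have hp1 := hp.1
        rw [hsymm, indicator_of_mem (circleMap_mem_ball_one (by linarith [hp1.1]) hp1.2),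
          smul_eq_mul, ← mul_assoc]
        refine le_mul_of_one_le_left zero_le ?_
        rw [← ENNReal.ofReal_ofNat, ← ENNReal.ofReal_mul (by norm_num), ENNReal.one_le_ofReal]
        linarith [hp1.1]
    _ = 2 * ∫⁻ p in Ioo (1 / 2 : ℝ) 1 ×ˢ Ioo α β, (ENNReal.ofReal p.1 •
        (ball (0 : ℂ) 1).indicator (fun z => ‖deriv f z‖ₑ) (Complex.polarCoord.symm p)) :=
        lintegral_const_mul' _ _ (by simp)
    _ ≤ 2 * ∫⁻ p in polarCoord.target, (ENNReal.ofReal p.1 •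
        (ball (0 : ℂ) 1).indicator (fun z => ‖deriv f z‖ₑ) (Complex.polarCoord.symm p)) := by
        gcongr
        rw [polarCoord_target]
        exact prod_mono (fun x hx => lt_trans (by norm_num) hx.1) (Ioo_subset_Ioo hα hβ)
    _ < ⊤ := ENNReal.mul_lt_top (by simp) hf

theorem enorm_circleMap_le_lintegral_enorm_deriv {f : ℂ → ℂ}
    (hd : DifferentiableOn ℂ f (ball 0 1)) {θ r : ℝ} (hr0 : 0 ≤ r)
    (hhit : ∀ ε > 0, ∃ ρ ∈ Ioo r 1, ‖f (circleMap 0 ρ θ)‖ < ε) :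
    ‖f (circleMap 0 r θ)‖ₑ ≤ ∫⁻ ρ in Ioo r 1, ‖deriv f (circleMap 0 ρ θ)‖ₑ := by
  refine ENNReal.le_of_forall_pos_le_add fun ε hε _ => ?_
  obtain ⟨ρ, hρ, hsmall⟩ := hhit ε hε
  have hmem : ∀ s ∈ Icc r ρ, circleMap 0 s θ ∈ ball (0 : ℂ) 1 := fun s hs =>
    circleMap_mem_ball_one (hr0.trans hs.1) (hs.2.trans_lt hρ.2)
  have hcm : ∀ s : ℝ, HasDerivAt (fun s : ℝ => circleMap 0 s θ) (Complex.exp (θ * Complex.I)) s := by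
    intro s
    simp only [circleMap_zero]
    simpa using (Complex.ofRealCLM.hasDerivAt (x := s)).mul_const (Complex.exp (θ * Complex.I))
  have hcc : Continuous (fun s : ℝ => circleMap 0 s θ) :=
    continuous_iff_continuousAt.2 fun s => (hcm s).continuousAt
  have hFTC := intervalIntegral.integral_eq_sub_of_hasDerivAt
    (f := fun s : ℝ => f (circleMap 0 s θ)) (a := r) (b := ρ)
    (f' := fun s : ℝ => deriv f (circleMap 0 s θ) * Complex.exp (θ * Complex.I))
    (fun s hs => by
      rw [uIcc_of_le hρ.1.le] at hs
      exact ((hd.differentiableAt (isOpen_ball.mem_nhds (hmem s hs))).hasDerivAt).comp s (hcm s))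
    (by
      refine ContinuousOn.intervalIntegrable ?_
      rw [uIcc_of_le hρ.1.le]
      exact ((hd.deriv isOpen_ball).continuousOn.comp hcc.continuousOn hmem).mul continuousOn_const)
  have hsub : f (circleMap 0 r θ) = f (circleMap 0 ρ θ) -
      ∫ s in r..ρ, deriv f (circleMap 0 s θ) * Complex.exp (θ * Complex.I) := by
    rw [hFTC]; ring
  rw [hsub, add_comm]
  refine (enorm_sub_le).trans (add_le_add ?_ ?_)
  · rw [← ofReal_norm, ← ENNReal.ofReal_coe_nnreal]
    exact ENNReal.ofReal_le_ofReal hsmall.le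
  · rw [intervalIntegral.integral_of_le hρ.1.le]
    refine (enorm_integral_le_lintegral_enorm _).trans ?_
    have : ∀ s : ℝ, ‖deriv f (circleMap 0 s θ) * Complex.exp (θ * Complex.I)‖ₑ =
        ‖deriv f (circleMap 0 s θ)‖ₑ := fun s => by
      rw [← ofReal_norm, norm_mul, Complex.norm_exp_ofReal_mul_I, mul_one, ofReal_norm]
    simp_rw [this]
    exact lintegral_mono_set fun s hs => ⟨hs.1, hs.2.trans_lt hρ.2⟩

theorem tendsto_lintegral_arc {f : ℂ → ℂ} (hd : DifferentiableOn ℂ f (ball 0 1))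
    (hf : ∫⁻ z in ball (0 : ℂ) 1, ‖deriv f z‖ₑ < ⊤) {α β : ℝ} (hα : -Real.pi ≤ α)
    (hβ : β ≤ Real.pi)
    (hhit : ∀ θ ∈ Ioo α β, ∀ r < 1, ∀ ε > 0, ∃ ρ ∈ Ioo r 1, ‖f (circleMap 0 ρ θ)‖ < ε) :
    Tendsto (fun r => ∫⁻ θ in Ioo α β, ‖f (circleMap 0 r θ)‖ₑ) (𝓝[<] (1 : ℝ)) (𝓝 0) := by
  have hfin := lintegral_enorm_deriv_polar_lt_top hf hα hβ
  set S := Ioo (1 / 2 : ℝ) 1 ×ˢ Ioo α β with hSdef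
  have hlim : Tendsto (fun r : ℝ => (volume.restrict S) (Ioo r 1 ×ˢ Ioo α β)) (𝓝[<] 1) (𝓝 0) := by
    have : Tendsto (fun r : ℝ => ENNReal.ofReal (1 - r) * ENNReal.ofReal (β - α)) (𝓝[<] 1)
        (𝓝 0) := by
      have h1 : Tendsto (fun r : ℝ => ENNReal.ofReal (1 - r)) (𝓝[<] 1) (𝓝 0) := by
        have : Continuous fun r : ℝ => ENNReal.ofReal (1 - r) :=
          ENNReal.continuous_ofReal.comp (by fun_prop)
        simpa using (this.tendsto 1).mono_left nhdsWithin_le_nhds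
      simpa using ENNReal.Tendsto.mul_const h1 (Or.inr ENNReal.ofReal_ne_top)
    refine tendsto_of_tendsto_of_tendsto_of_le_of_le tendsto_const_nhds this
      (fun r => zero_le) fun r => ?_
    refine (Measure.restrict_apply_le _ _).trans ?_
    rw [Measure.volume_eq_prod, Measure.prod_prod, Real.volume_Ioo, Real.volume_Ioo]
  have h0 := tendsto_setLIntegral_zero hfin.ne hlim
  refine tendsto_of_tendsto_of_tendsto_of_le_of_le' tendsto_const_nhds h0
    (Eventually.of_forall fun r => zero_le) ?_
  filter_upwards [Ioo_mem_nhdsLT (show (1 / 2 : ℝ) < 1 by norm_num)] with r hr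
  have hmeas : Measurable fun p : ℝ × ℝ => ‖deriv f (circleMap 0 p.1 p.2)‖ₑ := by
    have : Measurable fun p : ℝ × ℝ => circleMap 0 p.1 p.2 := by
      simp only [circleMap_zero]; fun_prop
    exact ((measurable_deriv f).comp this).enorm
  rw [Measure.restrict_restrict (measurableSet_Ioo.prod measurableSet_Ioo), hSdef,
    inter_eq_self_of_subset_left (prod_mono (Ioo_subset_Ioo_left hr.1.le) subset_rfl),
    Measure.volume_eq_prod, ← Measure.prod_restrict, lintegral_prod_symm' _ hmeas]
  refine setLIntegral_mono' measurableSet_Ioo fun θ hθ => ?_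
  exact enorm_circleMap_le_lintegral_enorm_deriv hd (by linarith [hr.1]) (hhit θ hθ r hr.2)

/-- A bounded univalent function which gets arbitrarily small along every radius ending in an arc
of the unit circle vanishes at the origin. -/
theorem apply_zero_eq_zero_of_small_on_radii {f : ℂ → ℂ}
    (hd : DifferentiableOn ℂ f (ball 0 1)) (hi : InjOn f (ball 0 1)) {M : ℝ}
    (hM : ∀ z ∈ ball (0 : ℂ) 1, ‖f z‖ ≤ M) {α β : ℝ} (hαβ : α < β) (hα : -Real.pi ≤ α)
    (hβ : β ≤ Real.pi)
    (hhit : ∀ θ ∈ Ioo α β, ∀ r < 1, ∀ ε > 0, ∃ ρ ∈ Ioo r 1, ‖f (circleMap 0 ρ θ)‖ < ε) :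
    f 0 = 0 := by
  obtain ⟨n, hn⟩ := exists_nat_gt (2 * Real.pi / (β - α))
  have hδ : α + 2 * Real.pi / (n + 1) ≤ β := by
    have : 2 * Real.pi / (n + 1) ≤ β - α := by
      rw [div_lt_iff₀ (sub_pos.2 hαβ)] at hn
      rw [div_le_iff₀ (by positivity)]
      nlinarith
    linarith
  have hδ0 : 0 < 2 * Real.pi / (n + 1 : ℝ) := by positivity
  set β' : ℝ := α + 2 * Real.pi / (n + 1)
  have h0 := tendsto_lintegral_arc (β := β') hd (lintegral_enorm_deriv_lt_top hd hi hM) hα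
    (hδ.trans hβ) fun θ hθ => hhit θ ⟨hθ.1, hθ.2.trans_le hδ⟩
  have h1 := (ENNReal.tendsto_toReal ENNReal.zero_ne_top).comp h0
  have h2 := ((h1.const_mul (M ^ n)).const_mul (n + 1 : ℝ)).const_mul (2 * Real.pi)⁻¹
  simp only [ENNReal.toReal_zero, mul_zero] at h2
  have h3 : ‖f 0‖ ^ (n + 1) ≤ 0 := by
    refine ge_of_tendsto h2 ?_
    filter_upwards [Ioo_mem_nhdsLT (show (0 : ℝ) < 1 from one_pos)] with r hr
    have hc : Continuous fun θ => f (circleMap 0 r θ) :=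
      hd.continuousOn.comp_continuous (continuous_circleMap 0 r) fun θ =>
        circleMap_mem_ball_one hr.1.le hr.2
    have h4 := norm_pow_le_integral_arc hd hM n α hr.1 hr.2
    rwa [intervalIntegral.integral_of_le (by linarith), integral_Ioc_eq_integral_Ioo,
      integral_norm_eq_lintegral_enorm hc.aestronglyMeasurable] at h4
  exact norm_eq_zero.1 (pow_eq_zero_iff n.succ_ne_zero |>.1 (h3.antisymm (by positivity)))

/-- If a bounded univalent function on the disk tends to `0` along a curve approaching the unit
circle and does not vanish at the origin, the curve has at most one cluster point. -/
theorem eq_of_mapClusterPt_of_tendsto_zero {f : ℂ → ℂ}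
    (hd : DifferentiableOn ℂ f (ball 0 1)) (hi : InjOn f (ball 0 1)) {M : ℝ}
    (hM : ∀ z ∈ ball (0 : ℂ) 1, ‖f z‖ ≤ M) (hf0 : f 0 ≠ 0)
    {Γ : ℝ → ℂ} (hΓ : ContinuousOn Γ (Ico 0 1)) (hball : ∀ t ∈ Ico (0 : ℝ) 1, Γ t ∈ ball (0 : ℂ) 1)
    (hnorm : Tendsto (fun t => ‖Γ t‖) (𝓝[<] 1) (𝓝 1))
    (hlim : Tendsto (fun t => f (Γ t)) (𝓝[<] 1) (𝓝 0)) {a b : ℂ}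
    (ha : MapClusterPt a (𝓝[<] (1 : ℝ)) Γ) (hb : MapClusterPt b (𝓝[<] (1 : ℝ)) Γ)
    (ha1 : ‖a‖ = 1) (hb1 : ‖b‖ = 1) : a = b := by
  by_contra hab
  have hne : ∀ᶠ t in 𝓝[<] (1 : ℝ), Γ t ≠ 0 := by
    filter_upwards [hnorm.eventually (lt_mem_nhds one_pos)] with t ht using norm_pos_iff.1 ht
  obtain ⟨u, hu, α, β, hαβ, hα, hβ, hfreq⟩ :=
    exists_rotation_frequently_arg_eq hΓ hne ha hb ha1 hb1 hab
  have hu0 : u ≠ 0 := norm_ne_zero_iff.1 (by simp [hu])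
  have hmaps : MapsTo (fun z => u⁻¹ * z) (ball (0 : ℂ) 1) (ball 0 1) := fun z hz => by
    simpa [hu] using hz
  refine hf0 ?_
  have := apply_zero_eq_zero_of_small_on_radii (f := fun z => f (u⁻¹ * z))
    (hd.comp (by fun_prop) hmaps)
    (hi.comp (mul_right_injective₀ (inv_ne_zero hu0)).injOn hmaps)
    (fun z hz => hM _ (hmaps hz)) hαβ hα hβ ?_
  · simpa using this
  intro θ hθ r hr ε hε
  have hsmall : ∀ᶠ t in 𝓝[<] (1 : ℝ), ‖f (Γ t)‖ < ε := by
    simpa using hlim.norm.eventually (gt_mem_nhds (by simpa using hε))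
  obtain ⟨t, ht, hr', hε', ht01⟩ := ((hfreq θ hθ).and_eventually
    ((hnorm.eventually (lt_mem_nhds hr)).and
      (hsmall.and (Ioo_mem_nhdsLT (show (0 : ℝ) < 1 from one_pos))))).exists
  refine ⟨‖Γ t‖, ⟨hr', by simpa using hball t ⟨ht01.1.le, ht01.2⟩⟩, ?_⟩
  have hz : circleMap 0 ‖Γ t‖ θ = u * Γ t := by
    have := Complex.norm_mul_exp_arg_mul_I (u * Γ t)
    rwa [ht, norm_mul, hu, one_mul, ← circleMap_zero] at this
  rwa [hz, inv_mul_cancel_left₀ hu0]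

theorem tendsto_norm_of_tendsto_notMem_image {ψ : ℂ → ℂ} (hψ : ContinuousOn ψ (ball 0 1)) {c : ℂ}
    (hc : ∀ z ∈ ball (0 : ℂ) 1, ψ z ≠ c) {ι : Type*} {l : Filter ι} {Γ : ι → ℂ}
    (hball : ∀ᶠ t in l, Γ t ∈ ball (0 : ℂ) 1) (hlim : Tendsto (fun t => ψ (Γ t)) l (𝓝 c)) :
    Tendsto (fun t => ‖Γ t‖) l (𝓝 1) := by
  refine tendsto_order.2 ⟨fun r hr => ?_, fun r hr => ?_⟩
  · have hsub : closedBall (0 : ℂ) r ⊆ ball 0 1 := closedBall_subset_ball hr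
    have hK := (isCompact_closedBall (0 : ℂ) r).image_of_continuousOn (hψ.mono hsub)
    have hcK : c ∉ ψ '' closedBall 0 r := fun ⟨z, hz, e⟩ => hc z (hsub hz) e
    filter_upwards [hlim.eventually (hK.isClosed.isOpen_compl.mem_nhds hcK)] with t ht
    by_contra! hle
    exact ht (mem_image_of_mem ψ (by simpa using hle))
  · filter_upwards [hball] with t ht using (mem_ball_zero_iff.1 ht).trans hr

theorem phi_limit_along_accessible_arc
    (G : Set ℂ) (hGopen : IsOpen G) (hGconn : IsConnected G)
    (hGsc : SimplyConnectedSpace ↥G) (hGbd : (frontier G).Nontrivial)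
    (ψ : ℂ → ℂ) (hψd : DifferentiableOn ℂ ψ (Metric.ball (0 : ℂ) 1))
    (hψi : Set.InjOn ψ (Metric.ball (0 : ℂ) 1))
    (hψs : ψ '' Metric.ball (0 : ℂ) 1 = G)
    (φ : ℂ → ℂ) (hφψ : ∀ z ∈ Metric.ball (0 : ℂ) 1, φ (ψ z) = z)
    (hψφ : ∀ w ∈ G, ψ (φ w) = w ∧ φ w ∈ Metric.ball (0 : ℂ) 1)
    (lam : ℂ) (hlam : lam ∈ frontier G)
    (γ : ℝ → ℂ) (hγc : ContinuousOn γ (Set.Icc 0 1))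
    (hγi : Set.InjOn γ (Set.Icc 0 1))
    (hγG : γ '' Set.Ico 0 1 ⊆ G) (hγ1 : γ 1 = lam) :
    ∃ L ∈ Metric.sphere (0 : ℂ) 1,
      Filter.Tendsto (fun t => φ (γ t)) (nhdsWithin 1 (Set.Iio 1)) (nhds L) := by
  have homit : ∀ z ∈ ball (0 : ℂ) 1, ψ z ≠ lam := by
    rintro z hz rfl
    rw [hGopen.frontier_eq] at hlam
    exact hlam.2 (hψs ▸ mem_image_of_mem ψ hz)
  have hmem : ∀ t ∈ Ico (0 : ℝ) 1, γ t ∈ G := fun t ht => hγG (mem_image_of_mem γ ht)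
  have hball : ∀ t ∈ Ico (0 : ℝ) 1, φ (γ t) ∈ ball (0 : ℂ) 1 := fun t ht => (hψφ _ (hmem t ht)).2
  have hev : ∀ᶠ t in 𝓝[<] (1 : ℝ), t ∈ Ico (0 : ℝ) 1 := Ico_mem_nhdsLT one_pos
  have hφc : ContinuousOn φ G := by
    intro w hw
    have hz := (hψφ w hw).2
    have hle : 𝓝 w ≤ map ψ (𝓝 (φ w)) := by
      simpa only [(hψφ w hw).1] using nhds_le_map_nhds_of_injOn isOpen_ball hψd hψi hz
    refine ContinuousAt.continuousWithinAt ?_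
    refine (tendsto_map'_iff.2 ?_).mono_left hle
    refine tendsto_id.congr' ?_
    filter_upwards [isOpen_ball.mem_nhds hz] with z hz using (hφψ z hz).symm
  have hΓc : ContinuousOn (fun t => φ (γ t)) (Ico 0 1) :=
    hφc.comp (hγc.mono Ico_subset_Icc_self) hmem
  have hγlim : Tendsto γ (𝓝[<] 1) (𝓝 lam) := by
    have := hγc 1 ⟨zero_le_one, le_rfl⟩
    rw [ContinuousWithinAt, hγ1] at this
    refine this.mono_left (le_inf inf_le_left (le_principal_iff.2 ?_))
    filter_upwards [hev] with t ht using Ico_subset_Icc_self ht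
  have hψlim : Tendsto (fun t => ψ (φ (γ t))) (𝓝[<] 1) (𝓝 lam) := by
    refine hγlim.congr' ?_
    filter_upwards [hev] with t ht using ((hψφ _ (hmem t ht)).1).symm
  have hnorm := tendsto_norm_of_tendsto_notMem_image hψd.continuousOn homit (hev.mono hball) hψlim
  obtain ⟨f, hfd, hfi, hf0, ⟨M, hM⟩, C, hC⟩ := exists_bounded_injOn_of_omits hψd hψi homit
  have hflim : Tendsto (fun t => f (φ (γ t))) (𝓝[<] 1) (𝓝 0) := by
    have h1 : Tendsto (fun t => C * ‖ψ (φ (γ t)) - lam‖) (𝓝[<] 1) (𝓝 0) := by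
      simpa using ((hψlim.sub_const lam).norm).const_mul C
    have h2 : Tendsto (fun t => ‖f (φ (γ t))‖ ^ 2) (𝓝[<] 1) (𝓝 0) := by
      refine tendsto_of_tendsto_of_tendsto_of_le_of_le' tendsto_const_nhds h1
        (Eventually.of_forall fun t => by positivity) ?_
      filter_upwards [hev] with t ht using hC _ (hball t ht)
    rw [tendsto_zero_iff_norm_tendsto_zero]
    simpa using h2.sqrt
  have hclus : ∀ a, MapClusterPt a (𝓝[<] (1 : ℝ)) (fun t => φ (γ t)) → ‖a‖ = 1 := by
    intro a ha
    have h1 : MapClusterPt ‖a‖ (𝓝[<] (1 : ℝ)) (fun t => ‖φ (γ t)‖) :=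
      ha.continuousAt_comp (f := fun z : ℂ => ‖z‖) continuous_norm.continuousAt
    have h2 : ClusterPt ‖a‖ (𝓝 (1 : ℝ)) := h1.clusterPt.mono hnorm
    exact eq_of_nhds_neBot h2
  have hcomp : IsCompact (closedBall (0 : ℂ) 1) := isCompact_closedBall 0 1
  have hin : ∀ᶠ t in 𝓝[<] (1 : ℝ), φ (γ t) ∈ closedBall (0 : ℂ) 1 := by
    filter_upwards [hev] with t ht using ball_subset_closedBall (hball t ht)
  obtain ⟨L, -, hL⟩ := hcomp.exists_mapClusterPt (tendsto_principal.2 hin)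
  refine ⟨L, by simpa using hclus L hL, ?_⟩
  refine hcomp.tendsto_nhds_of_unique_mapClusterPt hin fun a _ ha => ?_
  exact eq_of_mapClusterPt_of_tendsto_zero hfd hfi hM hf0 hΓc hball hnorm hflim ha hL
    (hclus a ha) (hclus L hL)
end

section
/- Let G ⊆ ℂ be a simply connected domain whose boundary contains more than one point, let ψ be a univalent analytic map from the open unit disk D onto G, and let φ : G → D be its inverse. If J is a crosscut of G, then φ(J) is a crosscut of D: there exists a continuous injective map δ : [0,1] → ℂ with δ((0,1)) = φ(J), δ(0), δ(1) on the unit circle, and δ(0) ≠ δ(1). -/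
/-- `J` is a crosscut of `G`: `J = γ((0,1))` for a continuous injective
`γ : [0,1] → ℂ` with `γ((0,1)) ⊆ G` and endpoints `γ 0, γ 1 ∈ ∂G`. -/
def IsCrosscut (G J : Set ℂ) : Prop :=
  ∃ γ : ℝ → ℂ, ContinuousOn γ (Set.Icc 0 1) ∧ Set.InjOn γ (Set.Icc 0 1) ∧
    J = γ '' Set.Ioo 0 1 ∧ J ⊆ G ∧ γ 0 ∈ frontier G ∧ γ 1 ∈ frontier G

/-- The set `∂ₐG` of accessible boundary points of `G`. -/
def accessiblePts (G : Set ℂ) : Set ℂ :=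
  {a | a ∈ frontier G ∧ ∃ γ : ℝ → ℂ, ContinuousOn γ (Set.Icc 0 1) ∧
    Set.InjOn γ (Set.Icc 0 1) ∧ γ '' Set.Ico 0 1 ⊆ G ∧ γ 1 = a}

/-- The set `∂ₙG = ∂G \ ∂ₐG` of non-accessible boundary points of `G`. -/
def nonAccessiblePts (G : Set ℂ) : Set ℂ := frontier G \ accessiblePts G

/-- The set `∂ₛₙG` of semi-unreachable boundary points of `G`. -/
def semiUnreachablePts (G : Set ℂ) : Set ℂ :=
  {a | a ∈ frontier G ∧ ∃ J U V : Set ℂ, IsCrosscut G J ∧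
    IsOpen U ∧ IsOpen V ∧ IsConnected U ∧ IsConnected V ∧ Disjoint U V ∧
    G \ J = U ∪ V ∧ a ∈ (nonAccessiblePts U ∪ nonAccessiblePts V) \ J}

open Set Filter Topology MeasureTheory

theorem lintegral_annulus_inv_sq_le {α β : ℝ} (hα : 0 < α) (hαβ : α < β) :
    ∫⁻ w in {w : ℂ | α < ‖w‖ ∧ ‖w‖ < β}, ENNReal.ofReal (1 / ‖w‖ ^ 2) ≤
      ENNReal.ofReal (2 * Real.pi * Real.log (β / α)) := by
  have hmeas : MeasurableSet {w : ℂ | α < ‖w‖ ∧ ‖w‖ < β} :=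
    ((isOpen_lt continuous_const continuous_norm).inter
      (isOpen_lt continuous_norm continuous_const)).measurableSet
  rw [← lintegral_indicator hmeas, ← Complex.lintegral_comp_polarCoord_symm]
  have hle : ∀ p ∈ polarCoord.target, ENNReal.ofReal p.1 •
      ({w : ℂ | α < ‖w‖ ∧ ‖w‖ < β}.indicator (fun w => ENNReal.ofReal (1 / ‖w‖ ^ 2))
        (Complex.polarCoord.symm p)) ≤
      (Ioo α β).indicator (fun r => ENNReal.ofReal (1 / r)) p.1 *
        (Ioo (-Real.pi) Real.pi).indicator (fun _ => 1) p.2 := by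
    rintro ⟨r, θ⟩ hp
    rw [polarCoord_target] at hp
    have hr : 0 < r := hp.1
    have hn : ‖Complex.polarCoord.symm (r, θ)‖ = r := by
      rw [Complex.norm_polarCoord_symm, abs_of_pos hr]
    by_cases h : α < r ∧ r < β
    · rw [indicator_of_mem (by rw [mem_ofPred_eq, hn]; exact h), indicator_of_mem (by exact h),
        indicator_of_mem hp.2, hn, smul_eq_mul, ← ENNReal.ofReal_mul hr.le, mul_one]
      apply le_of_eq
      congr 1
      field_simp
    · rw [indicator_of_notMem (by rw [mem_ofPred_eq, hn]; exact h)]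
      simp
  have hmt : MeasurableSet polarCoord.target := polarCoord.open_target.measurableSet
  refine (setLIntegral_mono' hmt hle).trans ((setLIntegral_le_lintegral _ _).trans ?_)
  rw [Measure.volume_eq_prod, lintegral_prod_mul
    (Measurable.indicator (by fun_prop) measurableSet_Ioo).aemeasurable
    (Measurable.indicator (by fun_prop) measurableSet_Ioo).aemeasurable,
    lintegral_indicator measurableSet_Ioo, lintegral_indicator measurableSet_Ioo,
    setLIntegral_one, Real.volume_Ioo]
  have hint : IntervalIntegrable (fun r : ℝ => 1 / r) volume α β := by
    apply ContinuousOn.intervalIntegrable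
    rw [uIcc_of_le hαβ.le]
    exact continuousOn_const.div continuousOn_id fun x hx => (hα.trans_le hx.1).ne'
  rw [Measure.restrict_congr_set Ioo_ae_eq_Ioc, ← ofReal_integral_eq_lintegral_ofReal
    ((intervalIntegrable_iff_integrableOn_Ioc_of_le hαβ.le).1 hint)
    ((ae_restrict_mem measurableSet_Ioc).mono fun x hx => by
      have : 0 < x := hα.trans hx.1
      simp only [Pi.zero_apply]
      positivity),
    ← intervalIntegral.integral_of_le hαβ.le, integral_one_div_of_pos hα (hα.trans hαβ),
    ← ENNReal.ofReal_mul (Real.log_nonneg (by rw [le_div_iff₀ hα]; linarith))]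
  apply ENNReal.ofReal_le_ofReal
  linarith

theorem setLIntegral_norm_deriv_sq_div_le {Ω : Set ℂ} (hΩ : IsOpen Ω) {F : ℂ → ℂ}
    (hF : DifferentiableOn ℂ F Ω) (hinj : InjOn F Ω) {α β : ℝ} (hα : 0 < α) (hαβ : α < β) :
    ∫⁻ z in Ω ∩ F ⁻¹' {w : ℂ | α < ‖w‖ ∧ ‖w‖ < β},
      ENNReal.ofReal (‖deriv F z‖ ^ 2 / ‖F z‖ ^ 2) ≤
      ENNReal.ofReal (2 * Real.pi * Real.log (β / α)) := by
  have ho : IsOpen {w : ℂ | α < ‖w‖ ∧ ‖w‖ < β} :=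
    (isOpen_lt continuous_const continuous_norm).inter
      (isOpen_lt continuous_norm continuous_const)
  have hS : IsOpen (Ω ∩ F ⁻¹' {w : ℂ | α < ‖w‖ ∧ ‖w‖ < β}) :=
    hF.continuousOn.isOpen_inter_preimage hΩ ho
  have hder : ∀ z ∈ Ω ∩ F ⁻¹' {w : ℂ | α < ‖w‖ ∧ ‖w‖ < β},
      HasFDerivWithinAt F ((fderiv ℂ F z).restrictScalars ℝ)
        (Ω ∩ F ⁻¹' {w : ℂ | α < ‖w‖ ∧ ‖w‖ < β}) z := fun z hz =>
    ((hF.differentiableAt (hΩ.mem_nhds hz.1)).hasFDerivAt.restrictScalars ℝ).hasFDerivWithinAt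
  have hdet : ∀ z, |((fderiv ℂ F z).restrictScalars ℝ).det| = ‖deriv F z‖ ^ 2 := by
    intro z
    have h1 : ((fderiv ℂ F z).restrictScalars ℝ).det = ‖deriv F z‖ ^ 2 := by
      have := LinearMap.det_restrictScalars (R := ℝ) (f := (fderiv ℂ F z : ℂ →ₗ[ℂ] ℂ))
      rw [Algebra.norm_complex_apply, LinearMap.det_ring, Complex.normSq_eq_norm_sq] at this
      refine Eq.trans ?_ (this.trans (by simp))
      rfl
    rw [h1, abs_of_nonneg (by positivity)]
  have hcov := lintegral_image_eq_lintegral_abs_det_fderiv_mul volume hS.measurableSet hder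
    (hinj.mono inter_subset_left) (fun w => ENNReal.ofReal (1 / ‖w‖ ^ 2))
  calc _ = ∫⁻ w in F '' (Ω ∩ F ⁻¹' {w : ℂ | α < ‖w‖ ∧ ‖w‖ < β}),
        ENNReal.ofReal (1 / ‖w‖ ^ 2) := by
        rw [hcov]
        refine lintegral_congr fun z => ?_
        rw [hdet, ← ENNReal.ofReal_mul (by positivity)]
        congr 1
        ring
    _ ≤ _ := (lintegral_mono_set (by rintro _ ⟨z, hz, rfl⟩; exact hz.2)).trans
        (lintegral_annulus_inv_sq_le hα hαβ)

theorem exists_Icc_crossing {u : ℝ → ℝ} {y₁ y₂ A B : ℝ} (hy : y₁ ≤ y₂)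
    (hu : ContinuousOn u (Icc y₁ y₂)) (hAB : A < B) (h₁ : u y₁ ≤ A) (h₂ : B ≤ u y₂) :
    ∃ c d, c < d ∧ Icc c d ⊆ Icc y₁ y₂ ∧ u c = A ∧ u d = B ∧ ∀ y ∈ Ioo c d, A < u y ∧ u y < B := by
  obtain ⟨c, ⟨hcI, hcA⟩, hcmax⟩ : ∃ c, IsGreatest (Icc y₁ y₂ ∩ u ⁻¹' {A}) c := by
    obtain ⟨c, hc, hcA⟩ := intermediate_value_Icc hy hu ⟨h₁, hAB.le.trans h₂⟩
    exact (isCompact_Icc.of_isClosed_subset (hu.preimage_isClosed_of_isClosed isClosed_Icc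
      isClosed_singleton) inter_subset_left).exists_isGreatest ⟨c, hc, hcA⟩
  have hcu : ContinuousOn u (Icc c y₂) := hu.mono (Icc_subset_Icc hcI.1 le_rfl)
  simp only [mem_preimage, mem_singleton_iff] at hcA
  obtain ⟨d, ⟨hdI, hdB⟩, hdmin⟩ : ∃ d, IsLeast (Icc c y₂ ∩ u ⁻¹' {B}) d := by
    obtain ⟨d, hd, hdB⟩ := intermediate_value_Icc hcI.2 hcu ⟨hcA.le.trans hAB.le, h₂⟩
    exact (isCompact_Icc.of_isClosed_subset (hcu.preimage_isClosed_of_isClosed isClosed_Icc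
      isClosed_singleton) inter_subset_left).exists_isLeast ⟨d, hd, hdB⟩
  simp only [mem_preimage, mem_singleton_iff] at hdB
  have hcd : c < d := lt_of_le_of_ne hdI.1 (by rintro rfl; linarith)
  refine ⟨c, d, hcd, Icc_subset_Icc hcI.1 hdI.2, hcA, hdB, fun y hy' => ⟨?_, ?_⟩⟩
  · by_contra! h
    obtain ⟨e, he, heA⟩ := intermediate_value_Icc hy'.2.le
      (hcu.mono (Icc_subset_Icc hy'.1.le hdI.2)) ⟨h, hdB ▸ hAB.le⟩
    have := hcmax ⟨⟨hcI.1.trans (hy'.1.le.trans he.1), he.2.trans hdI.2⟩, heA⟩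
    linarith [hy'.1, he.1]
  · by_contra! h
    obtain ⟨e, he, heB⟩ := intermediate_value_Icc hy'.1.le
      (hcu.mono (Icc_subset_Icc le_rfl (hy'.2.le.trans hdI.2))) ⟨hcA ▸ hAB.le, h⟩
    have := hdmin ⟨⟨he.1, he.2.trans (hy'.2.le.trans hdI.2)⟩, heB⟩
    linarith [hy'.2, he.2]

theorem exists_uIcc_crossing {u : ℝ → ℝ} {y₁ y₂ A B : ℝ}
    (hu : ContinuousOn u (uIcc y₁ y₂)) (hAB : A < B) (h₁ : u y₁ ≤ A) (h₂ : B ≤ u y₂) :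
    ∃ c d, c < d ∧ Icc c d ⊆ uIcc y₁ y₂ ∧ |u d - u c| = B - A ∧
      ∀ y ∈ Ioo c d, A < u y ∧ u y < B := by
  rcases le_total y₁ y₂ with hy | hy
  · rw [uIcc_of_le hy] at hu ⊢
    obtain ⟨c, d, hcd, hsub, hc, hd, h⟩ := exists_Icc_crossing hy hu hAB h₁ h₂
    exact ⟨c, d, hcd, hsub, by rw [hc, hd, abs_of_pos (by linarith)], h⟩
  · rw [uIcc_of_ge hy] at hu ⊢
    obtain ⟨c, d, hcd, hsub, hc, hd, h⟩ := exists_Icc_crossing (u := -u) hy hu.neg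
      (neg_lt_neg hAB) (neg_le_neg h₂) (neg_le_neg h₁)
    simp only [Pi.neg_apply, neg_inj] at hc hd h
    refine ⟨c, d, hcd, hsub, by rw [hc, hd, abs_of_neg (by linarith)]; ring, fun y hy => ?_⟩
    have := h y hy
    constructor <;> linarith

theorem sq_log_norm_sub_div_le_lintegral {f f' : ℝ → ℂ} {c d L : ℝ} (hcd : c ≤ d) (hL : d - c ≤ L)
    (hL₀ : 0 < L) (hf : ∀ y ∈ Icc c d, HasDerivAt f (f' y) y) (hf' : ContinuousOn f' (Icc c d))
    (hf₀ : ∀ y ∈ Icc c d, f y ≠ 0) :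
    ENNReal.ofReal (|Real.log ‖f d‖ - Real.log ‖f c‖| ^ 2 / L) ≤
      ∫⁻ y in Ioo c d, ENNReal.ofReal (‖f' y‖ ^ 2 / ‖f y‖ ^ 2) := by
  set m := |Real.log ‖f d‖ - Real.log ‖f c‖| with hm
  have hfc : ContinuousOn f (Icc c d) := fun y hy => (hf y hy).continuousAt.continuousWithinAt
  have hg : ∀ y ∈ Icc c d, HasDerivAt (fun y => Real.log ‖f y‖)
      (inner ℝ (f y) (f' y) / ‖f y‖ ^ 2) y := by
    intro y hy
    have h := ((hf y hy).norm_sq.log (by simpa using hf₀ y hy)).const_mul (1 / 2 : ℝ)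
    refine (h.congr_deriv (by ring)).congr_of_eventuallyEq (Eventually.of_forall fun y => ?_)
    simp [Real.log_pow]
  have hqc : ContinuousOn (fun y => ‖f' y‖ / ‖f y‖) (Icc c d) :=
    hf'.norm.div hfc.norm fun y hy => by simpa using hf₀ y hy
  have hgc : ContinuousOn (fun y => inner ℝ (f y) (f' y) / ‖f y‖ ^ 2) (Icc c d) :=
    (hfc.inner hf').div (hfc.norm.pow 2) fun y hy => by simpa using hf₀ y hy
  rw [← uIcc_of_le hcd] at hqc hgc
  have hftc := intervalIntegral.integral_eq_sub_of_hasDerivAt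
    (fun y hy => hg y (by rwa [uIcc_of_le hcd] at hy)) hgc.intervalIntegrable
  have hm_le : m ≤ ∫ y in c..d, ‖f' y‖ / ‖f y‖ := by
    rw [hm, ← hftc, ← Real.norm_eq_abs]
    refine intervalIntegral.norm_integral_le_of_norm_le hcd (ae_of_all _ fun y hy => ?_)
      hqc.intervalIntegrable
    have h0 : 0 < ‖f y‖ := by simpa using hf₀ y ⟨hy.1.le, hy.2⟩
    rw [norm_div, norm_pow, norm_norm, div_le_div_iff₀ (by positivity) h0]
    have := norm_inner_le_norm (𝕜 := ℝ) (f y) (f' y)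
    nlinarith
  have hsq : m ^ 2 / L ≤ ∫ y in c..d, (‖f' y‖ / ‖f y‖) ^ 2 := by
    have h1 : ∫ y in c..d, (2 * (m / L) * (‖f' y‖ / ‖f y‖) - (m / L) ^ 2) ≤
        ∫ y in c..d, (‖f' y‖ / ‖f y‖) ^ 2 := by
      refine intervalIntegral.integral_mono_on hcd
        ((hqc.intervalIntegrable.const_mul _).sub intervalIntegrable_const)
        (hqc.pow 2).intervalIntegrable fun y _ => ?_
      nlinarith [sq_nonneg (‖f' y‖ / ‖f y‖ - m / L)]
    rw [intervalIntegral.integral_sub (hqc.intervalIntegrable.const_mul _)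
      intervalIntegrable_const, intervalIntegral.integral_const_mul,
      intervalIntegral.integral_const, smul_eq_mul] at h1
    have h2 : 2 * (m / L) * m ≤ 2 * (m / L) * ∫ y in c..d, ‖f' y‖ / ‖f y‖ := by gcongr
    have h3 : (d - c) * (m / L) ^ 2 ≤ L * (m / L) ^ 2 := by gcongr
    have h4 : 2 * (m / L) * m - L * (m / L) ^ 2 = m ^ 2 / L := by field_simp; ring
    linarith
  have hint : IntervalIntegrable (fun y => (‖f' y‖ / ‖f y‖) ^ 2) volume c d :=
    (hqc.pow 2).intervalIntegrable
  refine (ENNReal.ofReal_le_ofReal hsq).trans (le_of_eq ?_)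
  rw [intervalIntegral.integral_of_le hcd, ofReal_integral_eq_lintegral_ofReal
    ((intervalIntegrable_iff_integrableOn_Ioc_of_le hcd).1 hint)
    (ae_of_all _ fun y => by positivity), Measure.restrict_congr_set Ioo_ae_eq_Ioc]
  simp_rw [div_pow]

theorem log_div_mul_le_of_crossing {Ω : Set ℂ} (hΩ : IsOpen Ω) {F : ℂ → ℂ}
    (hF : DifferentiableOn ℂ F Ω) (hinj : InjOn F Ω) (hF₀ : ∀ z ∈ Ω, F z ≠ 0)
    {α β L p q : ℝ} (hα : 0 < α) (hαβ : α < β) (hL : 0 < L)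
    (h : ∀ x ∈ Ioo p q, ∃ y₁ y₂ : ℝ, |y₂ - y₁| ≤ L ∧ (∀ y ∈ uIcc y₁ y₂, (⟨x, y⟩ : ℂ) ∈ Ω) ∧
      ‖F ⟨x, y₁⟩‖ ≤ α ∧ β ≤ ‖F ⟨x, y₂⟩‖) :
    Real.log (β / α) * (q - p) ≤ 2 * Real.pi * L := by
  set m := Real.log (β / α) with hm
  have hm₀ : 0 < m := Real.log_pos (by rw [lt_div_iff₀ hα]; linarith)
  set S := Ω ∩ F ⁻¹' {w : ℂ | α < ‖w‖ ∧ ‖w‖ < β} with hS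
  have hSo : IsOpen S := hF.continuousOn.isOpen_inter_preimage hΩ
    ((isOpen_lt continuous_const continuous_norm).inter
      (isOpen_lt continuous_norm continuous_const))
  have hdF : ContinuousOn (deriv F) Ω := (hF.deriv hΩ).continuousOn
  set k : ℂ → ENNReal := S.indicator fun z => ENNReal.ofReal (‖deriv F z‖ ^ 2 / ‖F z‖ ^ 2) with hk
  have hkm : AEMeasurable k volume := by
    rw [hk, aemeasurable_indicator_iff hSo.measurableSet]
    refine (ContinuousOn.aemeasurable ?_ hSo.measurableSet).ennreal_ofReal
    exact ((hdF.norm.pow 2).div (hF.continuousOn.norm.pow 2)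
      fun z hz => by simpa using hF₀ z hz).mono inter_subset_left
  have hup : ∫⁻ z, k z ≤ ENNReal.ofReal (2 * Real.pi * m) := by
    rw [hk, lintegral_indicator hSo.measurableSet]
    exact setLIntegral_norm_deriv_sq_div_le hΩ hF hinj hα hαβ
  have hfub : ∫⁻ z, k z = ∫⁻ x : ℝ, ∫⁻ y : ℝ, k ⟨x, y⟩ := by
    have hmp := Complex.volume_preserving_equiv_real_prod.symm
    rw [← hmp.lintegral_comp_emb Complex.measurableEquivRealProd.symm.measurableEmbedding,
      Measure.volume_eq_prod, lintegral_prod _ (by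
        rw [← Measure.volume_eq_prod]
        exact hkm.comp_quasiMeasurePreserving hmp.quasiMeasurePreserving)]
    rfl
  have hline : ∀ x ∈ Ioo p q, ENNReal.ofReal (m ^ 2 / L) ≤ ∫⁻ y : ℝ, k ⟨x, y⟩ := by
    intro x hx
    obtain ⟨y₁, y₂, hyL, hyΩ, h₁, h₂⟩ := h x hx
    have hpath : ∀ y : ℝ, HasDerivAt (fun y : ℝ => (⟨x, y⟩ : ℂ)) Complex.I y := by
      intro y
      have := ((Complex.ofRealCLM.hasDerivAt (x := y)).mul_const Complex.I).const_add (x : ℂ)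
      simp only [Complex.ofRealCLM_apply, Complex.ofReal_one, one_mul] at this
      exact this.congr_of_eventuallyEq (Eventually.of_forall fun y => Complex.mk_eq_add_mul_I x y)
    have hpc : Continuous fun y : ℝ => (⟨x, y⟩ : ℂ) :=
      continuous_iff_continuousAt.2 fun y => (hpath y).continuousAt
    have hmaps : MapsTo (fun y : ℝ => (⟨x, y⟩ : ℂ)) (uIcc y₁ y₂) Ω := hyΩ
    have hFp : ContinuousOn (fun y : ℝ => F ⟨x, y⟩) (uIcc y₁ y₂) :=
      hF.continuousOn.comp hpc.continuousOn hmaps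
    have hlogc : ContinuousOn (fun y : ℝ => Real.log ‖F ⟨x, y⟩‖) (uIcc y₁ y₂) :=
      hFp.norm.log fun y hy => by simpa using hF₀ _ (hyΩ y hy)
    have hpos : ∀ y ∈ uIcc y₁ y₂, 0 < ‖F ⟨x, y⟩‖ := fun y hy => by simpa using hF₀ _ (hyΩ y hy)
    obtain ⟨c, d, hcd, hsub, hcross, hIoo⟩ := exists_uIcc_crossing hlogc
      (Real.log_lt_log hα hαβ) (Real.log_le_log (hpos _ left_mem_uIcc) h₁)
      (Real.log_le_log (hα.trans hαβ) h₂)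
    have hlen : d - c ≤ L := by
      have := abs_sub_le_of_uIcc_subset_uIcc (uIcc_of_le hcd.le ▸ hsub)
      rw [abs_of_pos (by linarith)] at this
      linarith
    have hder : ∀ y ∈ Icc c d, HasDerivAt (fun y : ℝ => F ⟨x, y⟩)
        (Complex.I * deriv F ⟨x, y⟩) y := by
      intro y hy
      have := (hF.differentiableAt (hΩ.mem_nhds (hyΩ y (hsub hy)))).hasDerivAt.scomp y (hpath y)
      exact this
    have hderc : ContinuousOn (fun y : ℝ => Complex.I * deriv F ⟨x, y⟩) (Icc c d) :=
      continuousOn_const.mul (hdF.comp hpc.continuousOn (hmaps.mono_left hsub))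
    have key := sq_log_norm_sub_div_le_lintegral hcd.le hlen hL hder hderc
      fun y hy => hF₀ _ (hyΩ y (hsub hy))
    rw [hcross, ← Real.log_div (hα.trans hαβ).ne' hα.ne', ← hm] at key
    refine key.trans ?_
    rw [← lintegral_indicator measurableSet_Ioo]
    refine lintegral_mono fun y => ?_
    by_cases hy : y ∈ Ioo c d
    · have hyu := hsub (Ioo_subset_Icc_self hy)
      have hyS : (⟨x, y⟩ : ℂ) ∈ S :=
        ⟨hyΩ y hyu, (Real.log_lt_log_iff hα (hpos y hyu)).1 (hIoo y hy).1,
          (Real.log_lt_log_iff (hpos y hyu) (hα.trans hαβ)).1 (hIoo y hy).2⟩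
      simp only [hk]
      rw [indicator_of_mem hy, indicator_of_mem hyS, norm_mul, Complex.norm_I, one_mul]
    · rw [indicator_of_notMem hy]
      exact zero_le
  have hlow : ENNReal.ofReal (m ^ 2 / L * (q - p)) ≤ ∫⁻ z, k z := by
    rw [hfub, ENNReal.ofReal_mul (by positivity), ← Real.volume_Ioo, ← setLIntegral_const]
    exact (setLIntegral_mono' measurableSet_Ioo hline).trans (setLIntegral_le_lintegral _ _)
  have hfin := (ENNReal.ofReal_le_ofReal_iff (by positivity)).1 (hlow.trans hup)
  have hrw : m ^ 2 / L * (q - p) = m * (m * (q - p)) / L := by ring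
  rw [hrw, div_le_iff₀ hL] at hfin
  nlinarith

theorem not_frequently_re_lt_and_frequently_lt_re {ψ : ℂ → ℂ} {a : ℂ}
    (hψd : DifferentiableOn ℂ ψ (Metric.ball 0 1)) (hψi : InjOn ψ (Metric.ball 0 1))
    (ha : ∀ z ∈ Metric.ball (0 : ℂ) 1, ψ z ≠ a) {σ : ℝ → ℂ} (hσ : ContinuousOn σ (Ioo 0 1))
    (hσb : MapsTo σ (Ioo 0 1) (Metric.ball 0 1))
    (hlim : Tendsto (fun t => ψ (σ t)) (𝓝[<] 1) (𝓝 a)) {x₁ x₂ : ℝ} (hx : x₁ < x₂) :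
    ¬((∃ᶠ t in 𝓝[<] 1, (σ t).re < x₁) ∧ ∃ᶠ t in 𝓝[<] 1, x₂ < (σ t).re) := by
  rintro ⟨hf₁, hf₂⟩
  have hIoo : ∀ᶠ t : ℝ in 𝓝[<] 1, t ∈ Ioo (0 : ℝ) 1 := Ioo_mem_nhdsLT one_pos
  have hre : ∀ z ∈ Metric.ball (0 : ℂ) 1, |z.re| < 1 := fun z hz =>
    (Complex.abs_re_le_norm z).trans_lt (by simpa using hz)
  have hx₁ : -1 < x₁ := by
    obtain ⟨t, ht, ht'⟩ := (hf₁.and_eventually hIoo).exists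
    linarith [(abs_lt.1 (hre _ (hσb ht'))).1]
  have hx₂ : x₂ < 1 := by
    obtain ⟨t, ht, ht'⟩ := (hf₂.and_eventually hIoo).exists
    linarith [(abs_lt.1 (hre _ (hσb ht'))).2]
  have hmid : MapsTo (fun x : ℝ => (x : ℂ)) (Icc x₁ x₂) (Metric.ball 0 1) := by
    intro x hx
    have : |x| < 1 := abs_lt.2 ⟨by linarith [hx.1], by linarith [hx.2]⟩
    simpa using this
  obtain ⟨x₀, hx₀, hmin⟩ := isCompact_Icc.exists_isMinOn (nonempty_Icc.2 hx.le)
    (((hψd.continuousOn.comp Complex.continuous_ofReal.continuousOn hmid).sub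
      (continuousOn_const (c := a))).norm)
  set b := ‖ψ (x₀ : ℂ) - a‖ with hb
  have hb₀ : 0 < b := norm_pos_iff.2 (sub_ne_zero.2 (ha _ (hmid hx₀)))
  set K := (2 * Real.pi + 1) / (x₂ - x₁) with hK
  have hK₀ : 0 < K := div_pos (by positivity) (by linarith)
  set α := b * Real.exp (-K) with hα
  have hα₀ : 0 < α := by positivity
  have hαb : α < b := mul_lt_of_lt_one_right hb₀ (Real.exp_lt_one_iff.2 (by linarith))
  have hev : ∀ᶠ t in 𝓝[<] (1 : ℝ), ‖ψ (σ t) - a‖ < α := by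
    filter_upwards [hlim (Metric.ball_mem_nhds a hα₀)] with t ht
    exact mem_ball_iff_norm.1 ht
  obtain ⟨t₀, ht₀, hsub⟩ := mem_nhdsLT_iff_exists_Ioo_subset.1 (hev.and hIoo)
  have hmem : ∀ᶠ t : ℝ in 𝓝[<] 1, t ∈ Ioo t₀ 1 := Ioo_mem_nhdsLT ht₀
  obtain ⟨t₁, h₁, ht₁⟩ := (hf₁.and_eventually hmem).exists
  obtain ⟨t₂, h₂, ht₂⟩ := (hf₂.and_eventually hmem).exists
  have huIcc : uIcc t₁ t₂ ⊆ Ioo t₀ 1 := ordConnected_Ioo.uIcc_subset ht₁ ht₂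
  have hcont : ContinuousOn (fun t => (σ t).re) (uIcc t₁ t₂) :=
    Complex.continuous_re.comp_continuousOn
      (hσ.mono fun t ht => (hsub (huIcc ht)).2)
  have key := log_div_mul_le_of_crossing Metric.isOpen_ball (hψd.sub_const a)
    (fun z hz w hw h => hψi hz hw (sub_left_injective h))
    (fun z hz => sub_ne_zero.2 (ha z hz)) hα₀ hαb one_pos (p := x₁) (q := x₂) (by
      intro x hxI
      obtain ⟨t, ht, htx⟩ := intermediate_value_uIcc hcont
        (Icc_subset_uIcc ⟨(h₁.trans hxI.1).le, (hxI.2.trans h₂).le⟩ : x ∈ _)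
      obtain ⟨htα, htI⟩ := hsub (huIcc ht)
      have hz : (⟨x, (σ t).im⟩ : ℂ) = σ t := Complex.ext htx.symm rfl
      have hball := hσb htI
      refine ⟨(σ t).im, 0, ?_, ?_, ?_, ?_⟩
      · rw [zero_sub, abs_neg]
        exact (Complex.abs_im_le_norm _).trans ((mem_ball_zero_iff.1 hball).le)
      · intro y hy
        have hy' : |y| ≤ |(σ t).im| := by
          have := abs_sub_le_of_uIcc_subset_uIcc (uIcc_subset_uIcc_right hy)
          simpa [abs_sub_comm] using this
        have hsq := sq_le_sq.2 hy'
        rw [mem_ball_zero_iff] at hball ⊢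
        rw [← hz] at hball
        refine lt_of_le_of_lt ?_ hball
        rw [Complex.norm_def, Complex.norm_def]
        apply Real.sqrt_le_sqrt
        simp only [Complex.normSq_apply]
        nlinarith
      · rw [hz]
        exact htα.le
      · exact hmin (Ioo_subset_Icc_self hxI))
  have hlog : Real.log (b / α) = K := by
    rw [hα, div_mul_cancel_left₀ hb₀.ne', ← Real.exp_neg, neg_neg, Real.log_exp]
  rw [hlog, hK, div_mul_cancel₀ _ (by linarith)] at key
  linarith

theorem exists_tendsto_re {ψ : ℂ → ℂ} {a : ℂ}
    (hψd : DifferentiableOn ℂ ψ (Metric.ball 0 1)) (hψi : InjOn ψ (Metric.ball 0 1))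
    (ha : ∀ z ∈ Metric.ball (0 : ℂ) 1, ψ z ≠ a) {σ : ℝ → ℂ} (hσ : ContinuousOn σ (Ioo 0 1))
    (hσb : MapsTo σ (Ioo 0 1) (Metric.ball 0 1))
    (hlim : Tendsto (fun t => ψ (σ t)) (𝓝[<] 1) (𝓝 a)) :
    ∃ x, Tendsto (fun t => (σ t).re) (𝓝[<] 1) (𝓝 x) := by
  have hbd : ∀ᶠ t in 𝓝[<] (1 : ℝ), |(σ t).re| ≤ 1 := by
    filter_upwards [Ioo_mem_nhdsLT one_pos] with t ht
    exact (Complex.abs_re_le_norm _).trans (mem_ball_zero_iff.1 (hσb ht)).le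
  exact tendsto_of_no_upcrossings dense_univ
    (fun x₁ _ x₂ _ hx => not_frequently_re_lt_and_frequently_lt_re hψd hψi ha hσ hσb hlim hx)
    (isBoundedUnder_of_eventually_le (hbd.mono fun t ht => (abs_le.1 ht).2))
    (isBoundedUnder_of_eventually_ge (hbd.mono fun t ht => (abs_le.1 ht).1))

/-- If the image under a univalent map of a path in the unit disk converges to a point outside the
image of the disk, then the path converges to a point of the unit circle. -/
theorem exists_tendsto_sphere {ψ : ℂ → ℂ} {a : ℂ}
    (hψd : DifferentiableOn ℂ ψ (Metric.ball 0 1)) (hψi : InjOn ψ (Metric.ball 0 1))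
    (ha : ∀ z ∈ Metric.ball (0 : ℂ) 1, ψ z ≠ a) {σ : ℝ → ℂ} (hσ : ContinuousOn σ (Ioo 0 1))
    (hσb : MapsTo σ (Ioo 0 1) (Metric.ball 0 1))
    (hlim : Tendsto (fun t => ψ (σ t)) (𝓝[<] 1) (𝓝 a)) :
    ∃ ζ : ℂ, ‖ζ‖ = 1 ∧ Tendsto σ (𝓝[<] 1) (𝓝 ζ) := by
  obtain ⟨x, hx⟩ := exists_tendsto_re hψd hψi ha hσ hσb hlim
  have hI : MapsTo (fun z : ℂ => Complex.I * z) (Metric.ball 0 1) (Metric.ball 0 1) := by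
    intro z hz
    simpa using hz
  obtain ⟨y, hy⟩ := exists_tendsto_re (ψ := fun z => ψ (Complex.I * z))
    (σ := fun t => -Complex.I * σ t) (a := a)
    (hψd.comp (differentiableOn_id.const_mul _) hI)
    (fun z hz w hw h => mul_left_cancel₀ Complex.I_ne_zero (hψi (hI hz) (hI hw) h))
    (fun z hz => ha _ (hI hz)) (continuousOn_const.mul hσ)
    (fun t ht => by simpa using hσb ht) (by simpa [← mul_assoc] using hlim)
  have hy' : Tendsto (fun t => (σ t).im) (𝓝[<] 1) (𝓝 y) := by simpa using hy
  have hζ : Tendsto σ (𝓝[<] 1) (𝓝 (⟨x, y⟩ : ℂ)) := by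
    have := ((Complex.continuous_ofReal.tendsto x).comp hx).add
      (((Complex.continuous_ofReal.tendsto y).comp hy').mul_const Complex.I)
    rw [← Complex.mk_eq_add_mul_I] at this
    exact this.congr fun t => Complex.re_add_im _
  have hle : ‖(⟨x, y⟩ : ℂ)‖ ≤ 1 := le_of_tendsto hζ.norm (by
    filter_upwards [Ioo_mem_nhdsLT one_pos] with t ht
    exact (mem_ball_zero_iff.1 (hσb ht)).le)
  refine ⟨⟨x, y⟩, hle.antisymm (not_lt.1 fun hlt => ?_), hζ⟩
  have hmem : (⟨x, y⟩ : ℂ) ∈ Metric.ball (0 : ℂ) 1 := mem_ball_zero_iff.2 hlt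
  have hcts := hψd.continuousOn.continuousAt (Metric.isOpen_ball.mem_nhds hmem)
  exact ha _ hmem (tendsto_nhds_unique (hcts.tendsto.comp hζ) hlim)

theorem exists_forall_lt_exists_eq_of_tendsto_zero {g : ℝ → ℝ} (hg : ContinuousOn g (Ioo 0 1))
    (hg₀ : ∀ t ∈ Ioo (0 : ℝ) 1, 0 < g t) (hlim : Tendsto g (𝓝[<] 1) (𝓝 0)) {P : ℝ → Prop}
    (hP : ∀ᶠ t in 𝓝[<] 1, P t) :
    ∃ r₀ > 0, ∀ r ∈ Ioo 0 r₀, ∃ t ∈ Ioo (0 : ℝ) 1, P t ∧ g t = r := by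
  have hIoo : ∀ᶠ t : ℝ in 𝓝[<] 1, t ∈ Ioo (0 : ℝ) 1 := Ioo_mem_nhdsLT one_pos
  obtain ⟨t₀, ht₀, hsub⟩ := mem_nhdsLT_iff_exists_Ioo_subset.1 (hP.and hIoo)
  have hmem : ∀ᶠ t : ℝ in 𝓝[<] 1, t ∈ Ioo t₀ 1 := Ioo_mem_nhdsLT ht₀
  obtain ⟨t₁, ht₁⟩ := hmem.exists
  refine ⟨g t₁, hg₀ _ (hsub ht₁).2, fun r hr => ?_⟩
  obtain ⟨t₂, ht₂, h₂⟩ := (hmem.and (hlim.eventually (gt_mem_nhds hr.1))).exists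
  have huIcc : uIcc t₁ t₂ ⊆ Ioo t₀ 1 := ordConnected_Ioo.uIcc_subset ht₁ ht₂
  obtain ⟨t, ht, htr⟩ := intermediate_value_uIcc (hg.mono fun t ht => (hsub (huIcc ht)).2)
    (Icc_subset_uIcc' ⟨h₂.le, hr.2.le⟩ : r ∈ _)
  exact ⟨t, (hsub (huIcc ht)).2, (hsub (huIcc ht)).1, htr⟩

theorem norm_one_sub_exp_lt_one_iff (x y : ℝ) :
    ‖1 - Complex.exp ⟨x, y⟩‖ < 1 ↔ Real.exp x < 2 * Real.cos y := by
  have hsq : ‖1 - Complex.exp ⟨x, y⟩‖ ^ 2 = 1 - Real.exp x * (2 * Real.cos y - Real.exp x) := by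
    rw [← Complex.normSq_eq_norm_sq, Complex.normSq_apply]
    simp only [Complex.sub_re, Complex.one_re, Complex.sub_im, Complex.one_im, Complex.exp_re,
      Complex.exp_im]
    linear_combination Real.exp x ^ 2 * Real.sin_sq_add_cos_sq y
  rw [← sq_lt_one_iff₀ (norm_nonneg _), hsq, sub_lt_self_iff,
    mul_pos_iff_of_pos_left (Real.exp_pos x), sub_pos]

theorem abs_le_abs_or_abs_le_abs_of_mem_uIcc {y y₁ y₂ : ℝ} (hy : y ∈ uIcc y₁ y₂) :
    |y| ≤ |y₁| ∨ |y| ≤ |y₂| := by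
  rw [← le_sup_iff]
  rcases mem_uIcc.1 hy with h | h
  · exact abs_le_max_abs_abs h.1 h.2
  · rw [sup_comm]
    exact abs_le_max_abs_abs h.1 h.2

/-- Two paths in the unit disk that converge to the same point of the unit circle cannot have images
under a univalent map converging to distinct points. -/
theorem eq_of_tendsto_of_tendsto_sphere {ψ : ℂ → ℂ} {a b ζ : ℂ}
    (hψd : DifferentiableOn ℂ ψ (Metric.ball 0 1)) (hψi : InjOn ψ (Metric.ball 0 1))
    (ha : ∀ z ∈ Metric.ball (0 : ℂ) 1, ψ z ≠ a) (hζ : ‖ζ‖ = 1) {σ τ : ℝ → ℂ}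
    (hσ : ContinuousOn σ (Ioo 0 1)) (hσb : MapsTo σ (Ioo 0 1) (Metric.ball 0 1))
    (hτ : ContinuousOn τ (Ioo 0 1)) (hτb : MapsTo τ (Ioo 0 1) (Metric.ball 0 1))
    (hσζ : Tendsto σ (𝓝[<] 1) (𝓝 ζ)) (hτζ : Tendsto τ (𝓝[<] 1) (𝓝 ζ))
    (hσa : Tendsto (fun t => ψ (σ t)) (𝓝[<] 1) (𝓝 a))
    (hτb' : Tendsto (fun t => ψ (τ t)) (𝓝[<] 1) (𝓝 b)) : a = b := by
  by_contra hab
  have hζ₀ : ζ ≠ 0 := by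
    rintro rfl
    simp at hζ
  set d := ‖b - a‖ / 3 with hd
  have hd₀ : 0 < d := div_pos (norm_pos_iff.2 (sub_ne_zero.2 (Ne.symm hab))) three_pos
  have hdist : ∀ {ρ : ℝ → ℂ}, ContinuousOn ρ (Ioo 0 1) → MapsTo ρ (Ioo 0 1) (Metric.ball 0 1) →
      Tendsto ρ (𝓝[<] 1) (𝓝 ζ) → ∀ {P : ℝ → Prop}, (∀ᶠ t in 𝓝[<] 1, P t) →
      ∃ r₀ > 0, ∀ r ∈ Ioo 0 r₀, ∃ t ∈ Ioo (0 : ℝ) 1, P t ∧ ‖1 - ρ t / ζ‖ = r := by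
    intro ρ hρ hρb hρζ P hP
    refine exists_forall_lt_exists_eq_of_tendsto_zero
      (continuousOn_const.sub (hρ.div_const ζ)).norm (fun t ht => ?_) ?_ hP
    · refine norm_pos_iff.2 (sub_ne_zero.2 fun h => ?_)
      have : ρ t = ζ := ((div_eq_one_iff_eq hζ₀).1 h.symm)
      have h1 := hρb ht
      rw [this, mem_ball_zero_iff, hζ] at h1
      exact lt_irrefl _ h1
    · have := ((tendsto_const_nhds (x := (1 : ℂ))).sub (hρζ.div_const ζ)).norm
      simpa [hζ₀] using this
  obtain ⟨r₁, hr₁, h₁⟩ := hdist hσ hσb hσζ (P := fun t => ‖ψ (σ t) - a‖ ≤ d) (by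
    filter_upwards [hσa (Metric.ball_mem_nhds a hd₀)] with t ht
    exact (mem_ball_iff_norm.1 ht).le)
  obtain ⟨r₂, hr₂, h₂⟩ := hdist hτ hτb hτζ (P := fun t => 2 * d ≤ ‖ψ (τ t) - a‖) (by
    filter_upwards [hτb' (Metric.ball_mem_nhds b hd₀)] with t ht
    have h : ‖ψ (τ t) - b‖ < d := mem_ball_iff_norm.1 ht
    have h' := norm_sub_le (ψ (τ t) - a) (ψ (τ t) - b)
    rw [sub_sub_sub_cancel_left] at h'
    linarith)
  set Ω : Set ℂ := {z | |z.im| < Real.pi ∧ ‖1 - Complex.exp z‖ < 1} with hΩ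
  have hΩo : IsOpen Ω := by
    have h₁ : IsOpen {z : ℂ | |z.im| < Real.pi} :=
      isOpen_lt Complex.continuous_im.abs continuous_const
    have h₂ : IsOpen {z : ℂ | ‖1 - Complex.exp z‖ < 1} :=
      isOpen_lt (continuous_const.sub Complex.continuous_exp).norm continuous_const
    exact h₁.inter h₂
  have hmaps : MapsTo (fun z => ζ * (1 - Complex.exp z)) Ω (Metric.ball 0 1) := by
    intro z hz
    rw [mem_ball_zero_iff, norm_mul, hζ, one_mul]
    exact hz.2
  have hF : DifferentiableOn ℂ (fun z => ψ (ζ * (1 - Complex.exp z)) - a) Ω :=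
    (hψd.comp (by fun_prop) hmaps).sub_const a
  have hinj : InjOn (fun z => ψ (ζ * (1 - Complex.exp z)) - a) Ω := by
    intro z hz w hw h
    have h1 := mul_left_cancel₀ hζ₀ (hψi (hmaps hz) (hmaps hw) (sub_left_injective h))
    exact Complex.exp_inj_of_neg_pi_lt_of_le_pi (abs_lt.1 hz.1).1 (abs_lt.1 hz.1).2.le
      (abs_lt.1 hw.1).1 (abs_lt.1 hw.1).2.le (sub_right_injective h1)
  have hpolar : ∀ {x : ℝ} {z : ℂ}, z ∈ Metric.ball (0 : ℂ) 1 → ‖1 - z / ζ‖ = Real.exp x →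
      (⟨x, (1 - z / ζ).arg⟩ : ℂ) ∈ Ω ∧ ζ * (1 - Complex.exp ⟨x, (1 - z / ζ).arg⟩) = z := by
    intro x z hz hx
    have hexp : Complex.exp ⟨x, (1 - z / ζ).arg⟩ = 1 - z / ζ := by
      rw [Complex.mk_eq_add_mul_I, Complex.exp_add, ← Complex.ofReal_exp, ← hx,
        Complex.norm_mul_exp_arg_mul_I]
    have hlt : ‖z / ζ‖ < 1 := by
      rw [norm_div, hζ, div_one]
      simpa using hz
    refine ⟨⟨?_, ?_⟩, ?_⟩
    · have hre : 0 < (1 - z / ζ).re := by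
        have := (le_abs_self _).trans_lt ((Complex.abs_re_le_norm _).trans_lt hlt)
        rw [Complex.sub_re, Complex.one_re]
        linarith
      exact (Complex.abs_arg_lt_pi_div_two_iff.2 (Or.inl hre)).trans
        (half_lt_self Real.pi_pos)
    · rwa [hexp, sub_sub_cancel]
    · rw [hexp, sub_sub_cancel, mul_div_cancel₀ _ hζ₀]
  set x₀ := Real.log (min r₁ r₂) with hx₀
  set K := (4 * Real.pi ^ 2 + 1) / Real.log 2 with hK
  have hlog : 0 < Real.log 2 := Real.log_pos one_lt_two
  have key := log_div_mul_le_of_crossing hΩo hF hinj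
    (fun z hz => sub_ne_zero.2 (ha _ (hmaps hz))) hd₀ (by linarith : d < 2 * d)
    (by positivity : 0 < 2 * Real.pi) (p := x₀ - K) (q := x₀) (by
      intro x hx
      have hexp : Real.exp x < min r₁ r₂ := by
        rw [← Real.lt_log_iff_exp_lt (lt_min hr₁ hr₂)]
        exact hx.2
      obtain ⟨s, hs, hsd, hsx⟩ := h₁ (Real.exp x) ⟨Real.exp_pos x, hexp.trans_le (min_le_left _ _)⟩
      obtain ⟨t, ht, htd, htx⟩ := h₂ (Real.exp x) ⟨Real.exp_pos x, hexp.trans_le (min_le_right _ _)⟩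
      obtain ⟨hsΩ, hsψ⟩ := hpolar (hσb hs) hsx
      obtain ⟨htΩ, htψ⟩ := hpolar (hτb ht) htx
      refine ⟨(1 - σ s / ζ).arg, (1 - τ t / ζ).arg, ?_, fun y hy => ?_, ?_, ?_⟩
      · have h1 := abs_lt.1 hsΩ.1
        have h2 := abs_lt.1 htΩ.1
        simp only at h1 h2
        rw [abs_le]
        constructor <;> linarith
      · have hshrink : ∀ y' : ℝ, (⟨x, y'⟩ : ℂ) ∈ Ω → |y| ≤ |y'| → (⟨x, y⟩ : ℂ) ∈ Ω := by
          rintro y' ⟨h1, h2⟩ h3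
          refine ⟨h3.trans_lt h1, ?_⟩
          rw [norm_one_sub_exp_lt_one_iff] at h2 ⊢
          have := Real.cos_le_cos_of_nonneg_of_le_pi (abs_nonneg y) h1.le h3
          simp only [Real.cos_abs] at this
          linarith
        rcases abs_le_abs_or_abs_le_abs_of_mem_uIcc hy with h | h
        · exact hshrink _ hsΩ h
        · exact hshrink _ htΩ h
      · rwa [hsψ]
      · rwa [htψ])
  rw [mul_div_cancel_right₀ _ hd₀.ne', sub_sub_cancel, hK, mul_div_cancel₀ _ hlog.ne'] at key
  nlinarith

theorem continuousOn_leftInverse_of_isOpen_image {X Y : Type*} [TopologicalSpace X]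
    [TopologicalSpace Y] {f : X → Y} {g : Y → X} {U : Set X} (hU : IsOpen U)
    (hf : ∀ s ⊆ U, IsOpen s → IsOpen (f '' s)) (hg : ∀ x ∈ U, g (f x) = x) :
    ContinuousOn g (f '' U) := by
  rw [continuousOn_open_iff (hf U subset_rfl hU)]
  intro s hs
  have : f '' U ∩ g ⁻¹' s = f '' (U ∩ s) := by
    ext y
    constructor
    · rintro ⟨⟨x, hx, rfl⟩, hy⟩
      rw [mem_preimage, hg x hx] at hy
      exact ⟨x, ⟨hx, hy⟩, rfl⟩
    · rintro ⟨x, ⟨hx, hxs⟩, rfl⟩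
      refine ⟨⟨x, hx, rfl⟩, ?_⟩
      rwa [mem_preimage, hg x hx]
  rw [this]
  exact hf _ inter_subset_left (hU.inter hs)

theorem isOpen_image_ball_of_injOn {ψ : ℂ → ℂ} (hψd : DifferentiableOn ℂ ψ (Metric.ball 0 1))
    (hψi : InjOn ψ (Metric.ball 0 1)) {s : Set ℂ} (hs : s ⊆ Metric.ball 0 1) (hso : IsOpen s) :
    IsOpen (ψ '' s) := by
  refine ((hψd.analyticOnNhd Metric.isOpen_ball).is_constant_or_isOpen
    (convex_ball 0 1).isPreconnected).resolve_left ?_ s hs hso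
  rintro ⟨w, hw⟩
  have h0 : (0 : ℂ) ∈ Metric.ball (0 : ℂ) 1 := by simp
  have h1 : (1 / 2 : ℂ) ∈ Metric.ball (0 : ℂ) 1 := by
    rw [mem_ball_zero_iff]
    norm_num
  have := hψi h0 h1 ((hw _ h0).trans (hw _ h1).symm)
  norm_num at this

theorem image_of_crosscut_is_crosscut
    (G : Set ℂ) (hGopen : IsOpen G) (hGconn : IsConnected G)
    (hGsc : SimplyConnectedSpace ↥G) (hGbd : (frontier G).Nontrivial)
    (ψ : ℂ → ℂ) (hψd : DifferentiableOn ℂ ψ (Metric.ball (0 : ℂ) 1))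
    (hψi : Set.InjOn ψ (Metric.ball (0 : ℂ) 1))
    (hψs : ψ '' Metric.ball (0 : ℂ) 1 = G)
    (φ : ℂ → ℂ) (hφψ : ∀ z ∈ Metric.ball (0 : ℂ) 1, φ (ψ z) = z)
    (hψφ : ∀ w ∈ G, ψ (φ w) = w ∧ φ w ∈ Metric.ball (0 : ℂ) 1)
    (J : Set ℂ) (hJ : IsCrosscut G J) :
    ∃ δ : ℝ → ℂ, ContinuousOn δ (Set.Icc 0 1) ∧ Set.InjOn δ (Set.Icc 0 1) ∧
      δ '' Set.Ioo 0 1 = φ '' J ∧ δ 0 ∈ Metric.sphere (0 : ℂ) 1 ∧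
      δ 1 ∈ Metric.sphere (0 : ℂ) 1 ∧ δ 0 ≠ δ 1 := by
  obtain ⟨γ, hγ, hγi, rfl, hJG, hγ₀, hγ₁⟩ := hJ
  rw [hGopen.frontier_eq] at hγ₀ hγ₁
  have hγG : MapsTo γ (Ioo 0 1) G := fun t ht => hJG ⟨t, ht, rfl⟩
  have hφc : ContinuousOn φ G := hψs ▸ continuousOn_leftInverse_of_isOpen_image
    Metric.isOpen_ball (fun _ hs hso => isOpen_image_ball_of_injOn hψd hψi hs hso) hφψ
  have hσ : ContinuousOn (fun t => φ (γ t)) (Ioo 0 1) :=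
    hφc.comp (hγ.mono Ioo_subset_Icc_self) hγG
  have hσb : MapsTo (fun t => φ (γ t)) (Ioo 0 1) (Metric.ball 0 1) :=
    fun t ht => (hψφ _ (hγG ht)).2
  have hrefl : MapsTo (fun t : ℝ => 1 - t) (Ioo 0 1) (Ioo 0 1) :=
    fun t ht => ⟨by linarith [ht.2], by linarith [ht.1]⟩
  have hτ : ContinuousOn (fun t => φ (γ (1 - t))) (Ioo 0 1) :=
    hσ.comp (by fun_prop) hrefl
  have hτb : MapsTo (fun t => φ (γ (1 - t))) (Ioo 0 1) (Metric.ball 0 1) := hσb.comp hrefl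
  have hne : ∀ a ∉ G, ∀ z ∈ Metric.ball (0 : ℂ) 1, ψ z ≠ a := by
    rintro a ha z hz rfl
    exact ha (hψs ▸ mem_image_of_mem ψ hz)
  have hleft : Tendsto (fun t : ℝ => 1 - t) (𝓝[<] 1) (𝓝[>] 0) := by
    refine tendsto_nhdsWithin_iff.2 ⟨?_, ?_⟩
    · have : Tendsto (fun t : ℝ => 1 - t) (𝓝 1) (𝓝 (1 - 1)) :=
        (continuous_const.sub continuous_id).tendsto 1
      rw [sub_self] at this
      exact this.mono_left nhdsWithin_le_nhds
    · filter_upwards [self_mem_nhdsWithin] with t ht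
      simpa using ht
  have hright : Tendsto (fun t : ℝ => 1 - t) (𝓝[>] 0) (𝓝[<] 1) := by
    refine tendsto_nhdsWithin_iff.2 ⟨?_, ?_⟩
    · have : Tendsto (fun t : ℝ => 1 - t) (𝓝 0) (𝓝 (1 - 0)) :=
        (continuous_const.sub continuous_id).tendsto 0
      rw [sub_zero] at this
      exact this.mono_left nhdsWithin_le_nhds
    · filter_upwards [self_mem_nhdsWithin] with t ht
      simpa using ht
  have hlim₁ : Tendsto (fun t => ψ (φ (γ t))) (𝓝[<] 1) (𝓝 (γ 1)) := by
    have h := (hγ 1 (by simp)).mono_left (nhdsWithin_mono 1 Ioo_subset_Icc_self)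
    rw [nhdsWithin_Ioo_eq_nhdsLT one_pos] at h
    refine h.congr' ?_
    filter_upwards [Ioo_mem_nhdsLT one_pos] with t ht
    exact (hψφ _ (hγG ht)).1.symm
  have hlim₀ : Tendsto (fun t => ψ (φ (γ (1 - t)))) (𝓝[<] 1) (𝓝 (γ 0)) := by
    have h := (hγ 0 (by simp)).mono_left (nhdsWithin_mono 0 Ioo_subset_Icc_self)
    rw [nhdsWithin_Ioo_eq_nhdsGT one_pos] at h
    refine (h.comp hleft).congr' ?_
    filter_upwards [Ioo_mem_nhdsLT one_pos] with t ht
    exact (hψφ _ (hγG (hrefl ht))).1.symm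
  obtain ⟨ζ₁, hζ₁, hσζ⟩ := exists_tendsto_sphere hψd hψi (hne _ hγ₁.2) hσ hσb hlim₁
  obtain ⟨ζ₀, hζ₀, hτζ⟩ := exists_tendsto_sphere hψd hψi (hne _ hγ₀.2) hτ hτb hlim₀
  have hσζ₀ : Tendsto (fun t => φ (γ t)) (𝓝[>] 0) (𝓝 ζ₀) := by
    have := hτζ.comp hright
    simpa [Function.comp_def] using this
  have hζ : ζ₀ ≠ ζ₁ := by
    rintro rfl
    have := hγi (by simp) (by simp) (eq_of_tendsto_of_tendsto_sphere hψd hψi (hne _ hγ₁.2) hζ₁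
      hσ hσb hτ hτb hσζ hτζ hlim₁ hlim₀)
    norm_num at this
  set δ := extendFrom (Ioo 0 1) (fun t => φ (γ t)) with hδ
  have hδ₀ : δ 0 = ζ₀ := eq_lim_at_left_extendFrom_Ioo one_pos hσζ₀
  have hδ₁ : δ 1 = ζ₁ := eq_lim_at_right_extendFrom_Ioo one_pos hσζ
  have hδI : EqOn δ (fun t => φ (γ t)) (Ioo 0 1) := extendFrom_extends hσ
  have hδb : ∀ t ∈ Ioo (0 : ℝ) 1, ‖δ t‖ < 1 := fun t ht => by
    rw [hδI ht]
    simpa using hσb ht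
  have hδn₀ : ‖δ 0‖ = 1 := hδ₀ ▸ hζ₀
  have hδn₁ : ‖δ 1‖ = 1 := hδ₁ ▸ hζ₁
  have hδne : δ 0 ≠ δ 1 := by rwa [hδ₀, hδ₁]
  have hδinj : InjOn δ (Ioo 0 1) := by
    intro s hs t ht h
    rw [hδI hs, hδI ht] at h
    have h' := congrArg ψ h
    simp only [(hψφ _ (hγG hs)).1, (hψφ _ (hγG ht)).1] at h'
    exact hγi (Ioo_subset_Icc_self hs) (Ioo_subset_Icc_self ht) h'
  have hδinj' : InjOn δ (Icc 0 1) := by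
    rw [← Ico_insert_right zero_le_one, ← Ioo_insert_left one_pos,
      injOn_insert (by simp), injOn_insert (by simp)]
    refine ⟨⟨hδinj, ?_⟩, ?_⟩
    · rintro ⟨t, ht, h⟩
      exact (hδb t ht).ne (h ▸ hδn₀)
    · rintro ⟨t, rfl | ht, h⟩
      · exact hδne h
      · exact (hδb t ht).ne (h ▸ hδn₁)
  refine ⟨δ, continuousOn_Icc_extendFrom_Ioo hσ hσζ₀ hσζ, hδinj', ?_, ?_, ?_, hδne⟩
  · rw [hδI.image_eq, image_image]
  · simpa using hδn₀
  · simpa using hδn₁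
end
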